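/- arXiv:2112.02493 — 2 statements merged into one kernel-verified Lean document; each statement's English description precedes it below -/
import Mathlib

section
/- Let x̂ = (…, x_2, x_1) ∈ X+ be such that x_m ≤ p_m for all m ≥ 1, and let k ≥ 1. Then c'_{2l+i_k}·(x_{k+1} − p_{k+1}) − c'_{2l+i_k−1}·(x_k − p_k) ≤ 0 for all l ≥ 1 if and only if γ_{k+1}·p_{k+1} − p_k + x_k − γ_{k+1}·x_{k+1} ≥ 0. -/
open Filter Function

namespace HypCrystal

variable (a1 a2 k1 k2 : ℤ)

/-- `i_k`: 1 if `k` is odd, 2 if `k` is even. -/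
def idx (k : ℤ) : ℤ := if k % 2 = 1 then 1 else 2

/-- membership in the index set `I = {1,2}`. -/
def IsI (i : ℤ) : Prop := i = 1 ∨ i = 2

/-- `⟨α_{i_j}, α_{i_k}^∨⟩`. -/
def pairJK (j k : ℤ) : ℤ :=
  if j % 2 = k % 2 then 2 else if k % 2 = 1 then -a1 else -a2

/-- `⟨α_{i_j}, α_i^∨⟩` for `i ∈ {1,2}`. -/
def pairJI (j i : ℤ) : ℤ :=
  if idx j = i then 2 else if i = 1 then -a1 else -a2

/-- `α_{i_j}` in the `(Λ1, Λ2)`-coordinates. -/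
def alphaOf (j : ℤ) : ℤ × ℤ := if j % 2 = 1 then (2, -a2) else (-a1, 2)

/-- `⟨ν, α_i^∨⟩` for a weight `ν` in `(Λ1, Λ2)`-coordinates. -/
def pairW (ν : ℤ × ℤ) (i : ℤ) : ℤ := if i = 1 then ν.1 else ν.2

/-- the sequence `c_j`. -/
def cseq : ℕ → ℤ
  | 0 => 0
  | 1 => 1
  | j + 2 => (if j % 2 = 0 then a1 else a2) * cseq (j + 1) - cseq j

/-- the sequence `c'_j`. -/
def cseq' : ℕ → ℤ
  | 0 => 0
  | 1 => 1
  | j + 2 => (if j % 2 = 0 then a2 else a1) * cseq' (j + 1) - cseq' j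

noncomputable def alphaR : ℝ :=
  ((a1 : ℝ) * a2 + Real.sqrt ((a1 : ℝ) ^ 2 * (a2 : ℝ) ^ 2 - 4 * a1 * a2)) / (2 * a2)

noncomputable def betaR : ℝ :=
  ((a1 : ℝ) * a2 + Real.sqrt ((a1 : ℝ) ^ 2 * (a2 : ℝ) ^ 2 - 4 * a1 * a2)) / (2 * a1)

/-- `γ_k = α` if `k` even, `β` if `k` odd. -/
noncomputable def gammaR (k : ℤ) : ℝ := if k % 2 = 0 then alphaR a1 a2 else betaR a1 a2

/-- `p_m` for `m ≥ 0`. -/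
def ppos : ℕ → ℤ
  | 0 => k2
  | 1 => k1
  | m + 2 => (if m % 2 = 0 then a2 else a1) * ppos (m + 1) - ppos m

/-- `p_{-n}` for `n ≥ 0`. -/
def pneg : ℕ → ℤ
  | 0 => k2
  | 1 => a1 * k2 - k1
  | n + 2 => (if (n + 2) % 2 = 0 then a2 else a1) * pneg (n + 1) - pneg n

/-- the two-sided sequence `p_m`, `m ∈ ℤ`, with `p_0 = k2`, `p_1 = k1`. -/
def pseq (m : ℤ) : ℤ :=
  if 0 ≤ m then ppos a1 a2 k1 k2 m.toNat else pneg a1 a2 k1 k2 (-m).toNat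

/-- `λ = k1·Λ1 − k2·Λ2` in `(Λ1, Λ2)`-coordinates. -/
def lamW : ℤ × ℤ := (k1, -k2)

/-- membership in `ℤ^{+∞}` (coordinates supported on positions `≥ 1`, nonnegative,
finitely supported). -/
def ZPlusMem (x : ℤ → ℤ) : Prop :=
  (∀ k : ℤ, k ≤ 0 → x k = 0) ∧ (∀ k : ℤ, 0 ≤ x k) ∧ ∃ N : ℕ, ∀ k : ℤ, (N : ℤ) < k → x k = 0

/-- membership in `ℤ^{−∞}` (coordinates supported on positions `≤ 0`, nonpositive,
finitely supported). -/
def ZMinusMem (x : ℤ → ℤ) : Prop :=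
  (∀ k : ℤ, 1 ≤ k → x k = 0) ∧ (∀ k : ℤ, x k ≤ 0) ∧ ∃ N : ℕ, ∀ k : ℤ, k < -(N : ℤ) → x k = 0

/-- membership in `X+ = Img(Ψ⁺)`. -/
def XPlusMem (x : ℤ → ℤ) : Prop :=
  ZPlusMem x ∧ ∀ j : ℤ, 1 ≤ j →
    0 ≤ cseq a1 a2 j.toNat * x j - cseq a1 a2 (j - 1).toNat * x (j + 1)

/-- membership in `X− = Img(Ψ⁻)`. -/
def XMinusMem (x : ℤ → ℤ) : Prop :=
  ZMinusMem x ∧ ∀ j : ℤ, j ≤ 0 →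
    cseq' a1 a2 (1 - j).toNat * x j - cseq' a1 a2 (-j).toNat * x (j - 1) ≤ 0

def posPart (x : ℤ → ℤ) : ℤ → ℤ := fun k => if 1 ≤ k then x k else 0
def negPart (x : ℤ → ℤ) : ℤ → ℤ := fun k => if k ≤ 0 then x k else 0

/-- membership in `Z_ι(μ) = ℤ^{+∞} ⊗ t_μ ⊗ ℤ^{−∞}` (in coordinates). -/
def ZMem (x : ℤ → ℤ) : Prop := ZPlusMem (posPart x) ∧ ZMinusMem (negPart x)

/-- membership in `X+ ⊗ t_λ ⊗ X−` (in coordinates). -/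
def XXMem (x : ℤ → ℤ) : Prop := XPlusMem a1 a2 (posPart x) ∧ XMinusMem a1 a2 (negPart x)

/-- `σ_k` on `ℤ^{+∞}` (for `k ≥ 1`). -/
noncomputable def sigmaP (x : ℤ → ℤ) (k : ℤ) : ℤ :=
  x k + ∑ᶠ j : ℤ, if k < j then pairJK a1 a2 j k * x j else 0

/-- `σ_k` on `ℤ^{−∞}` (for `k ≤ 0`). -/
noncomputable def sigmaM (x : ℤ → ℤ) (k : ℤ) : ℤ :=
  -(x k) - ∑ᶠ j : ℤ, if j < k then pairJK a1 a2 j k * x j else 0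

/-- `−Σ_j x_j α_{i_j}` in `(Λ1, Λ2)`-coordinates. -/
noncomputable def wtOf (x : ℤ → ℤ) : ℤ × ℤ :=
  (-∑ᶠ j : ℤ, x j * (alphaOf a1 a2 j).1, -∑ᶠ j : ℤ, x j * (alphaOf a1 a2 j).2)

/-- `wt(x) = μ − Σ_j x_j α_{i_j}`. -/
noncomputable def wtZ (μ : ℤ × ℤ) (x : ℤ → ℤ) : ℤ × ℤ := μ + wtOf a1 a2 x

/-- `σ_k` on `Z_ι(μ)`. -/
noncomputable def sigmaZ (μ : ℤ × ℤ) (x : ℤ → ℤ) (k : ℤ) : ℤ :=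
  if 1 ≤ k then sigmaP a1 a2 x k
  else sigmaM a1 a2 x k - pairW (wtZ a1 a2 μ x) (idx k)

/-- `ε_i` on `Z_ι(μ)`. -/
noncomputable def epsZ (μ : ℤ × ℤ) (x : ℤ → ℤ) (i : ℤ) : ℤ :=
  sSup {s : ℤ | ∃ k : ℤ, idx k = i ∧ sigmaZ a1 a2 μ x k = s}

/-- `φ_i` on `Z_ι(μ)`. -/
noncomputable def phiZ (μ : ℤ × ℤ) (x : ℤ → ℤ) (i : ℤ) : ℤ :=
  epsZ a1 a2 μ x i + pairW (wtZ a1 a2 μ x) i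

noncomputable def kmaxZ (μ : ℤ × ℤ) (x : ℤ → ℤ) (i : ℤ) : ℤ :=
  sSup {k : ℤ | idx k = i ∧ sigmaZ a1 a2 μ x k = epsZ a1 a2 μ x i}

noncomputable def kminZ (μ : ℤ × ℤ) (x : ℤ → ℤ) (i : ℤ) : ℤ :=
  sInf {k : ℤ | idx k = i ∧ sigmaZ a1 a2 μ x k = epsZ a1 a2 μ x i}

/-- `ẽ_i` on `Z_ι(μ)`; `none` represents `0`. -/
noncomputable def eZ (μ : ℤ × ℤ) (i : ℤ) (x : ℤ → ℤ) : Option (ℤ → ℤ) :=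
  if 0 < epsZ a1 a2 μ x i then
    some (Function.update x (kmaxZ a1 a2 μ x i) (x (kmaxZ a1 a2 μ x i) - 1))
  else none

/-- `f̃_i` on `Z_ι(μ)`; `none` represents `0`. -/
noncomputable def fZ (μ : ℤ × ℤ) (i : ℤ) (x : ℤ → ℤ) : Option (ℤ → ℤ) :=
  if 0 < phiZ a1 a2 μ x i then
    some (Function.update x (kminZ a1 a2 μ x i) (x (kminZ a1 a2 μ x i) + 1))
  else none

/-- `ε_i` on `ℤ^{+∞}`. -/
noncomputable def epsP (x : ℤ → ℤ) (i : ℤ) : ℤ :=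
  sSup {s : ℤ | ∃ k : ℤ, 1 ≤ k ∧ idx k = i ∧ sigmaP a1 a2 x k = s}

noncomputable def kmaxP (x : ℤ → ℤ) (i : ℤ) : ℤ :=
  sSup {k : ℤ | 1 ≤ k ∧ idx k = i ∧ sigmaP a1 a2 x k = epsP a1 a2 x i}

noncomputable def kminP (x : ℤ → ℤ) (i : ℤ) : ℤ :=
  sInf {k : ℤ | 1 ≤ k ∧ idx k = i ∧ sigmaP a1 a2 x k = epsP a1 a2 x i}

/-- `ẽ_i` on `ℤ^{+∞}` (partial). -/
noncomputable def eP (i : ℤ) (x : ℤ → ℤ) : Option (ℤ → ℤ) :=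
  if 0 < epsP a1 a2 x i then
    some (Function.update x (kmaxP a1 a2 x i) (x (kmaxP a1 a2 x i) - 1))
  else none

/-- `f̃_i` on `ℤ^{+∞}` (total). -/
noncomputable def fP (i : ℤ) (x : ℤ → ℤ) : ℤ → ℤ :=
  Function.update x (kminP a1 a2 x i) (x (kminP a1 a2 x i) + 1)

/-- `φ_i` on `ℤ^{−∞}`. -/
noncomputable def phiMf (x : ℤ → ℤ) (i : ℤ) : ℤ :=
  sSup {s : ℤ | ∃ k : ℤ, k ≤ 0 ∧ idx k = i ∧ sigmaM a1 a2 x k = s}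

noncomputable def kmaxM (x : ℤ → ℤ) (i : ℤ) : ℤ :=
  sSup {k : ℤ | k ≤ 0 ∧ idx k = i ∧ sigmaM a1 a2 x k = phiMf a1 a2 x i}

noncomputable def kminM (x : ℤ → ℤ) (i : ℤ) : ℤ :=
  sInf {k : ℤ | k ≤ 0 ∧ idx k = i ∧ sigmaM a1 a2 x k = phiMf a1 a2 x i}

/-- `ẽ_i` on `ℤ^{−∞}` (total). -/
noncomputable def eM (i : ℤ) (x : ℤ → ℤ) : ℤ → ℤ :=
  Function.update x (kmaxM a1 a2 x i) (x (kmaxM a1 a2 x i) - 1)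

noncomputable def fPiter (i : ℤ) (n : ℕ) (x : ℤ → ℤ) : ℤ → ℤ := (fP a1 a2 i)^[n] x

noncomputable def eMiter (i : ℤ) (n : ℕ) (x : ℤ → ℤ) : ℤ → ℤ := (eM a1 a2 i)^[n] x

noncomputable def ePiterO (i : ℤ) (n : ℕ) (ox : Option (ℤ → ℤ)) : Option (ℤ → ℤ) :=
  (fun o => o.bind (eP a1 a2 i))^[n] ox

noncomputable def eZiterO (μ : ℤ × ℤ) (i : ℤ) (n : ℕ) (ox : Option (ℤ → ℤ)) : Option (ℤ → ℤ) :=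
  (fun o => o.bind (eZ a1 a2 μ i))^[n] ox

noncomputable def fZiterO (μ : ℤ × ℤ) (i : ℤ) (n : ℕ) (ox : Option (ℤ → ℤ)) : Option (ℤ → ℤ) :=
  (fun o => o.bind (fZ a1 a2 μ i))^[n] ox

noncomputable def suppBoundP (x : ℤ → ℤ) : ℕ := sInf {N : ℕ | ∀ k : ℤ, (N : ℤ) < k → x k = 0}

noncomputable def suppBoundM (x : ℤ → ℤ) : ℕ := sInf {N : ℕ | ∀ k : ℤ, k < -(N : ℤ) → x k = 0}

/-- `starPChain x n z = f̃_{i_1}^{x_1} ⋯ f̃_{i_n}^{x_n} (z)` on `ℤ^{+∞}`. -/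
noncomputable def starPChain (x : ℤ → ℤ) : ℕ → (ℤ → ℤ) → (ℤ → ℤ)
  | 0, z => z
  | n + 1, z => starPChain x n (fPiter a1 a2 (idx ((n : ℤ) + 1)) ((x ((n : ℤ) + 1)).toNat) z)

/-- the `∗`-operation on `X+`: `(x⁺)* = f̃_{i_1}^{x_1} ⋯ f̃_{i_N}^{x_N} (z_∞)`. -/
noncomputable def starP (x : ℤ → ℤ) : ℤ → ℤ :=
  starPChain a1 a2 x (suppBoundP x) (fun _ => 0)

/-- `starMChain x n z = ẽ_{i_0}^{−x_0} ⋯ ẽ_{i_{-(n-1)}}^{−x_{-(n-1)}} (z)` on `ℤ^{−∞}`. -/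
noncomputable def starMChain (x : ℤ → ℤ) : ℕ → (ℤ → ℤ) → (ℤ → ℤ)
  | 0, z => z
  | n + 1, z => starMChain x n (eMiter a1 a2 (idx (-(n : ℤ))) ((-(x (-(n : ℤ)))).toNat) z)

/-- the `∗`-operation on `X−`. -/
noncomputable def starM (x : ℤ → ℤ) : ℤ → ℤ :=
  starMChain a1 a2 x (suppBoundM x + 1) (fun _ => 0)

/-- combine a `ℤ^{+∞}`- and a `ℤ^{−∞}`-component into an element of `Z_ι(μ)`. -/
def combine (y z : ℤ → ℤ) : ℤ → ℤ := fun k => if 1 ≤ k then y k else z k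

/-- the coordinates of `x* = (x⁺)* ⊗ t_μ ⊗ (x⁻)*`. -/
noncomputable def xstarFun (x : ℤ → ℤ) : ℤ → ℤ :=
  combine (starP a1 a2 (posPart x)) (starM a1 a2 (negPart x))

/-- the weight `μ = −λ − wt(x⁺) − wt(x⁻)` of `x*`. -/
noncomputable def mustar (lam : ℤ × ℤ) (x : ℤ → ℤ) : ℤ × ℤ :=
  -lam - wtOf a1 a2 (posPart x) - wtOf a1 a2 (negPart x)

/-- `fPnegChain g n z = f̃_{i_{-(n-1)}}^{g(-(n-1))} ⋯ f̃_{i_{-1}}^{g(-1)} f̃_{i_0}^{g 0} (z)`. -/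
noncomputable def fPnegChain (g : ℤ → ℕ) : ℕ → (ℤ → ℤ) → (ℤ → ℤ)
  | 0, z => z
  | n + 1, z => fPiter a1 a2 (idx (-(n : ℤ))) (g (-(n : ℤ))) (fPnegChain g n z)

/-- `eMposChain g n z = ẽ_{i_n}^{g n} ⋯ ẽ_{i_2}^{g 2} ẽ_{i_1}^{g 1} (z)`. -/
noncomputable def eMposChain (g : ℤ → ℕ) : ℕ → (ℤ → ℤ) → (ℤ → ℤ)
  | 0, z => z
  | n + 1, z => eMiter a1 a2 (idx ((n : ℤ) + 1)) (g ((n : ℤ) + 1)) (eMposChain g n z)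

/-- `ePposChainO g n z = ẽ_{i_n}^{g n} ⋯ ẽ_{i_2}^{g 2} ẽ_{i_1}^{g 1} (z)` on `ℤ^{+∞}`. -/
noncomputable def ePposChainO (g : ℤ → ℕ) : ℕ → Option (ℤ → ℤ) → Option (ℤ → ℤ)
  | 0, z => z
  | n + 1, z => ePiterO a1 a2 (idx ((n : ℤ) + 1)) (g ((n : ℤ) + 1)) (ePposChainO g n z)

/-- the Weyl group action `S_i` on `Z_ι(μ) ∪ {0}`. -/
noncomputable def SiO (μ : ℤ × ℤ) (i : ℤ) (ob : Option (ℤ → ℤ)) : Option (ℤ → ℤ) :=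
  ob.bind fun b =>
    if 0 ≤ pairW (wtZ a1 a2 μ b) i then
      fZiterO a1 a2 μ i (pairW (wtZ a1 a2 μ b) i).toNat (some b)
    else eZiterO a1 a2 μ i (-(pairW (wtZ a1 a2 μ b) i)).toNat (some b)

/-- `SwPos μ n = S_{i_n} ⋯ S_{i_2} S_{i_1}`. -/
noncomputable def SwPos (μ : ℤ × ℤ) : ℕ → Option (ℤ → ℤ) → Option (ℤ → ℤ)
  | 0, b => b
  | n + 1, b => SiO a1 a2 μ (idx ((n : ℤ) + 1)) (SwPos μ n b)

/-- `SwNeg μ n = S_{i_{-(n-1)}} ⋯ S_{i_{-1}} S_{i_0}`. -/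
noncomputable def SwNeg (μ : ℤ × ℤ) : ℕ → Option (ℤ → ℤ) → Option (ℤ → ℤ)
  | 0, b => b
  | n + 1, b => SiO a1 a2 μ (idx (-(n : ℤ))) (SwNeg μ n b)

/-- `S_{w_k}`. -/
noncomputable def Swk (μ : ℤ × ℤ) (k : ℤ) (b : Option (ℤ → ℤ)) : Option (ℤ → ℤ) :=
  if 0 ≤ k then SwPos a1 a2 μ k.toNat b else SwNeg a1 a2 μ (-k).toNat b

/-- `b ∈ Z_ι(μ)` is extremal. -/
noncomputable def Extremal (μ : ℤ × ℤ) (b : ℤ → ℤ) : Prop :=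
  ∀ js : List ℤ, (∀ j ∈ js, IsI j) →
    ∃ b', js.foldr (SiO a1 a2 μ) (some b) = some b' ∧
      ∀ i : ℤ, IsI i →
        (0 ≤ pairW (wtZ a1 a2 μ b') i → eZ a1 a2 μ i b' = none) ∧
        (pairW (wtZ a1 a2 μ b') i ≤ 0 → fZ a1 a2 μ i b' = none)

/-- `φ(x) ≥ 0` for all `φ ∈ Ξ_ι[λ]`. -/
noncomputable def SigmaCond (x : ℤ → ℤ) : Prop :=
  (0 ≤ gammaR a1 a2 0 * (pseq a1 a2 k1 k2 0 : ℝ) + gammaR a1 a2 0 * (x 0 : ℝ) - (x 1 : ℝ)) ∧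
  (0 ≤ gammaR a1 a2 1 * (pseq a1 a2 k1 k2 1 : ℝ) + (x 0 : ℝ) - gammaR a1 a2 1 * (x 1 : ℝ)) ∧
  (∀ k : ℤ, 1 ≤ k → 0 ≤ (pseq a1 a2 k1 k2 k : ℝ) - (x k : ℝ)) ∧
  (∀ k : ℤ, 1 ≤ k → 0 ≤ gammaR a1 a2 k * (x k : ℝ) - (x (k + 1) : ℝ)) ∧
  (∀ k : ℤ, 1 ≤ k → 0 ≤ gammaR a1 a2 (k + 1) * (pseq a1 a2 k1 k2 (k + 1) : ℝ) -
      (pseq a1 a2 k1 k2 k : ℝ) + (x k : ℝ) - gammaR a1 a2 (k + 1) * (x (k + 1) : ℝ)) ∧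
  (∀ k : ℤ, k ≤ 0 → 0 ≤ (pseq a1 a2 k1 k2 k : ℝ) + (x k : ℝ)) ∧
  (∀ k : ℤ, k ≤ 0 → 0 ≤ (x (k - 1) : ℝ) - gammaR a1 a2 k * (x k : ℝ)) ∧
  (∀ k : ℤ, k ≤ 0 → 0 ≤ gammaR a1 a2 (k - 1) * (pseq a1 a2 k1 k2 (k - 1) : ℝ) -
      (pseq a1 a2 k1 k2 k : ℝ) + gammaR a1 a2 (k - 1) * (x (k - 1) : ℝ) - (x k : ℝ))

/-- membership in `Σ_ι[λ]`. -/
noncomputable def SigmaMem (x : ℤ → ℤ) : Prop :=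
  ZMem x ∧ SigmaCond a1 a2 k1 k2 x

/-- membership in `Σ'_ι[λ]`. -/
noncomputable def SigmaPrimeMem (x : ℤ → ℤ) : Prop :=
  SigmaMem a1 a2 k1 k2 x ∧ (∀ k : ℤ, k ≤ 0 → x k = 0) ∧ XPlusMem a1 a2 (posPart x)

/-- evaluation of an affine function `φ = (c, (φ_l)_l)` at `x`. -/
noncomputable def evalAff (φ : ℝ × (ℤ → ℝ)) (x : ℤ → ℤ) : ℝ :=
  φ.1 + ∑ᶠ l : ℤ, φ.2 l * (x l : ℝ)

/-- `a_{i_k}`. -/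
def aIdx (k : ℤ) : ℤ := if k % 2 = 1 then a1 else a2

/-- the affine function `b̄_k`. -/
noncomputable def bbar (lam : ℤ × ℤ) (k : ℤ) : ℝ × (ℤ → ℝ) :=
  ((if k = -1 ∨ k = 0 then -(pairW lam (idx k) : ℝ) else 0),
    fun l => (if l = k then (1 : ℝ) else 0) + (if l = k + 1 then -(aIdx a1 a2 k : ℝ) else 0) +
      (if l = k + 2 then (1 : ℝ) else 0))

/-- the operator `S̄_k` on affine functions. -/
noncomputable def SbarOp (lam : ℤ × ℤ) (k : ℤ) (φ : ℝ × (ℤ → ℝ)) : ℝ × (ℤ → ℝ) :=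
  let b := if 0 ≤ φ.2 k then bbar a1 a2 lam (k + 2) else bbar a1 a2 lam (k - 2)
  (φ.1 - φ.2 k * b.1, fun l => φ.2 l - φ.2 k * b.2 l)

end HypCrystal

namespace HypCrystal

variable {a1 a2 : ℤ}

lemma discriminant_nonneg (ha : 4 < a1 * a2) :
    (0 : ℝ) ≤ (a1 : ℝ) ^ 2 * (a2 : ℝ) ^ 2 - 4 * a1 * a2 := by
  have h : (4 : ℝ) < (a1 : ℝ) * a2 := by exact_mod_cast ha
  nlinarith

lemma alphaR_pos (ha2 : 1 ≤ a2) (ha : 4 < a1 * a2) : 0 < alphaR a1 a2 := by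
  have h : (4 : ℝ) < (a1 : ℝ) * a2 := by exact_mod_cast ha
  have h2 : (1 : ℝ) ≤ a2 := by exact_mod_cast ha2
  unfold alphaR
  positivity

lemma betaR_pos (ha1 : 1 ≤ a1) (ha : 4 < a1 * a2) : 0 < betaR a1 a2 := by
  have h : (4 : ℝ) < (a1 : ℝ) * a2 := by exact_mod_cast ha
  have h1 : (1 : ℝ) ≤ a1 := by exact_mod_cast ha1
  unfold betaR
  positivity

lemma alphaR_mul_betaR_add_one (ha1 : 1 ≤ a1) (ha2 : 1 ≤ a2) (ha : 4 < a1 * a2) :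
    alphaR a1 a2 * betaR a1 a2 + 1 = a1 * betaR a1 a2 := by
  have h1 : (a1 : ℝ) ≠ 0 := by exact_mod_cast (by omega : a1 ≠ 0)
  have h2 : (a2 : ℝ) ≠ 0 := by exact_mod_cast (by omega : a2 ≠ 0)
  have hs := Real.sq_sqrt (discriminant_nonneg ha)
  unfold alphaR betaR
  generalize Real.sqrt ((a1 : ℝ) ^ 2 * (a2 : ℝ) ^ 2 - 4 * a1 * a2) = s at hs ⊢
  field_simp
  linear_combination hs

lemma mul_alphaR_eq_mul_betaR (ha1 : 1 ≤ a1) (ha2 : 1 ≤ a2) :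
    a2 * alphaR a1 a2 = a1 * betaR a1 a2 := by
  have h1 : (a1 : ℝ) ≠ 0 := by exact_mod_cast (by omega : a1 ≠ 0)
  have h2 : (a2 : ℝ) ≠ 0 := by exact_mod_cast (by omega : a2 ≠ 0)
  unfold alphaR betaR
  field_simp

lemma one_lt_alphaR_mul_betaR (ha1 : 1 ≤ a1) (ha2 : 1 ≤ a2) (ha : 4 < a1 * a2) :
    1 < alphaR a1 a2 * betaR a1 a2 := by
  have h : (4 : ℝ) < (a1 : ℝ) * a2 := by exact_mod_cast ha
  have h1 : (1 : ℝ) ≤ a1 := by exact_mod_cast ha1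
  have h12 : (a1 : ℝ) * betaR a1 a2 = (a1 * a2 +
      Real.sqrt ((a1 : ℝ) ^ 2 * (a2 : ℝ) ^ 2 - 4 * a1 * a2)) / 2 := by
    unfold betaR
    field_simp
  linarith [alphaR_mul_betaR_add_one ha1 ha2 ha,
    Real.sqrt_nonneg ((a1 : ℝ) ^ 2 * (a2 : ℝ) ^ 2 - 4 * a1 * a2)]

/-- Consecutive terms of `c'` approach the ratios `α` and `β` geometrically. -/
lemma pow_mul_cseq'_sub (ha1 : 1 ≤ a1) (ha2 : 1 ≤ a2) (ha : 4 < a1 * a2) (m : ℕ) :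
    (alphaR a1 a2 * betaR a1 a2) ^ m *
        (cseq' a1 a2 (2 * m + 1) - alphaR a1 a2 * cseq' a1 a2 (2 * m)) = 1 ∧
      alphaR a1 a2 * (alphaR a1 a2 * betaR a1 a2) ^ m *
        (cseq' a1 a2 (2 * m + 2) - betaR a1 a2 * cseq' a1 a2 (2 * m + 1)) = 1 := by
  have hq := alphaR_mul_betaR_add_one ha1 ha2 ha
  have hq' : alphaR a1 a2 * betaR a1 a2 + 1 = a2 * alphaR a1 a2 :=
    hq.trans (mul_alphaR_eq_mul_betaR ha1 ha2).symm
  have even_step (n : ℕ) : (cseq' a1 a2 (2 * n + 2) : ℝ) =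
      a2 * cseq' a1 a2 (2 * n + 1) - cseq' a1 a2 (2 * n) := by
    simp [cseq']
  have odd_step (n : ℕ) : (cseq' a1 a2 (2 * n + 3) : ℝ) =
      a1 * cseq' a1 a2 (2 * n + 2) - cseq' a1 a2 (2 * n + 1) := by
    rw [cseq', if_neg (by omega)]
    push_cast
    rfl
  induction m with
  | zero =>
    refine ⟨by simp [cseq'], ?_⟩
    simp [cseq']
    linear_combination -hq'
  | succ m ih =>
    have odd_case : (alphaR a1 a2 * betaR a1 a2) ^ (m + 1) *
        (cseq' a1 a2 (2 * m + 3) - alphaR a1 a2 * cseq' a1 a2 (2 * m + 2)) = 1 := by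
      rw [odd_step, ← ih.2]
      linear_combination -(alphaR a1 a2 * (alphaR a1 a2 * betaR a1 a2) ^ m *
        cseq' a1 a2 (2 * m + 2)) * hq
    refine ⟨odd_case, ?_⟩
    rw [even_step (m + 1)]
    refine Eq.trans ?_ odd_case
    show alphaR a1 a2 * (alphaR a1 a2 * betaR a1 a2) ^ (m + 1) *
      (a2 * (cseq' a1 a2 (2 * m + 3) : ℝ) - cseq' a1 a2 (2 * m + 2) -
        betaR a1 a2 * cseq' a1 a2 (2 * m + 3)) = _
    linear_combination -((alphaR a1 a2 * betaR a1 a2) ^ (m + 1) *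
        cseq' a1 a2 (2 * m + 3)) * hq'

/-- The terms of `c'` grow at least geometrically. -/
lemma pow_le_cseq' (ha1 : 1 ≤ a1) (ha2 : 1 ≤ a2) (ha : 4 < a1 * a2) (m : ℕ) :
    (alphaR a1 a2 * betaR a1 a2) ^ m ≤ cseq' a1 a2 (2 * m + 1) ∧
      (alphaR a1 a2 * betaR a1 a2) ^ (m + 1) ≤ alphaR a1 a2 * cseq' a1 a2 (2 * m + 2) := by
  have hα := alphaR_pos ha2 ha
  have hβ := betaR_pos ha1 ha
  have hpow (n : ℕ) : 0 < (alphaR a1 a2 * betaR a1 a2) ^ n := by positivity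
  have odd_gap (n : ℕ) : alphaR a1 a2 * cseq' a1 a2 (2 * n) ≤ cseq' a1 a2 (2 * n + 1) := by
    have h := (pow_mul_cseq'_sub ha1 ha2 ha n).1
    exact sub_nonneg.1 (pos_of_mul_pos_right (h ▸ one_pos) (hpow n).le).le
  have even_gap (n : ℕ) :
      betaR a1 a2 * cseq' a1 a2 (2 * n + 1) ≤ cseq' a1 a2 (2 * n + 2) := by
    have h := (pow_mul_cseq'_sub ha1 ha2 ha n).2
    exact sub_nonneg.1 (pos_of_mul_pos_right (h ▸ one_pos) (mul_pos hα (hpow n)).le).le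
  have even_of_odd (n : ℕ)
      (h : (alphaR a1 a2 * betaR a1 a2) ^ n ≤ cseq' a1 a2 (2 * n + 1)) :
      (alphaR a1 a2 * betaR a1 a2) ^ (n + 1) ≤ alphaR a1 a2 * cseq' a1 a2 (2 * n + 2) :=
    calc (alphaR a1 a2 * betaR a1 a2) ^ (n + 1)
        = alphaR a1 a2 * (betaR a1 a2 * (alphaR a1 a2 * betaR a1 a2) ^ n) := by ring
      _ ≤ alphaR a1 a2 * (betaR a1 a2 * cseq' a1 a2 (2 * n + 1)) := by gcongr
      _ ≤ alphaR a1 a2 * cseq' a1 a2 (2 * n + 2) := by gcongr; exact even_gap n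
  induction m with
  | zero =>
    have h : (alphaR a1 a2 * betaR a1 a2) ^ 0 ≤ cseq' a1 a2 (2 * 0 + 1) := by simp [cseq']
    exact ⟨h, even_of_odd 0 h⟩
  | succ m ih =>
    have h := ih.2.trans (odd_gap (m + 1))
    exact ⟨h, even_of_odd (m + 1) h⟩

/-- If `u m / v m` tends to `γ` from above and `v` is unbounded, then the inequalities
`v m * z ≤ u m * y` for all `m ≥ 1` amount to `z ≤ γ * y`. -/
lemma forall_mul_le_iff_of_geometric {u v : ℕ → ℝ} {γ q C D y z : ℝ} (hq : 1 < q)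
    (hC : 0 < C) (hD : 0 < D) (hgap : ∀ m, C * q ^ m * (u m - γ * v m) = 1)
    (hgrowth : ∀ m, 1 ≤ m → q ^ m ≤ D * v m) (hy : 0 ≤ y) :
    (∀ m, 1 ≤ m → v m * z ≤ u m * y) ↔ z ≤ γ * y := by
  have hpow (m : ℕ) : 1 ≤ q ^ m := one_le_pow₀ hq.le
  have hpos (m : ℕ) : 0 < u m - γ * v m := by
    refine pos_of_mul_pos_right (hgap m ▸ one_pos) ?_
    have := hpow m
    positivity
  have hv (m : ℕ) (hm : 1 ≤ m) : 0 < v m :=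
    pos_of_mul_pos_right ((zero_lt_one.trans_le (hpow m)).trans_le (hgrowth m hm)) hD.le
  constructor
  · intro h
    by_contra! hlt
    obtain ⟨n, hn⟩ := pow_unbounded_of_one_lt (D * y / (C * (z - γ * y))) hq
    have hz : 0 < z - γ * y := sub_pos.2 hlt
    rw [div_lt_iff₀ (by positivity)] at hn
    have hn' : q ^ n ≤ q ^ (n + 1) := pow_le_pow_right₀ hq.le (Nat.le_succ n)
    have hle := h (n + 1) (by omega)
    have hbound : C * (u (n + 1) - γ * v (n + 1)) ≤ 1 := by
      nlinarith [hgap (n + 1), hpow (n + 1), mul_pos hC (hpos (n + 1))]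
    have hstep : v (n + 1) * (z - γ * y) ≤ (u (n + 1) - γ * v (n + 1)) * y := by linarith
    have : q ^ n * (C * (z - γ * y)) ≤ D * y :=
      calc q ^ n * (C * (z - γ * y)) ≤ D * v (n + 1) * (C * (z - γ * y)) := by
            gcongr
            exact hn'.trans (hgrowth (n + 1) (by omega))
        _ = C * D * (v (n + 1) * (z - γ * y)) := by ring
        _ ≤ C * D * ((u (n + 1) - γ * v (n + 1)) * y) := by gcongr
        _ = D * (C * (u (n + 1) - γ * v (n + 1)) * y) := by ring
        _ ≤ D * (1 * y) := by gcongr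
        _ = D * y := by ring
    linarith
  · intro h m hm
    nlinarith [mul_le_mul_of_nonneg_left h (hv m hm).le, mul_nonneg (hpos m).le hy]

end HypCrystal

open HypCrystal in
theorem cseq'_ineq_iff_gamma_ineq
    (a1 a2 : ℤ) (ha1 : 1 ≤ a1) (ha2 : 1 ≤ a2) (ha : 4 < a1 * a2)
    (k1 k2 : ℤ) (hk1 : 0 < k1) (hk2 : 0 < k2)
    (hreg : 2 ≤ a1 → 2 ≤ a2 →
      (k2 ≤ k1 ∧ k1 < (a1 - 1) * k2) ∨ (k1 < k2 ∧ k2 ≤ (a2 - 1) * k1))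
    (hdeg1 : a1 = 1 → 2 * k1 ≤ k2 ∧ k2 ≤ (a2 - 2) * k1)
    (hdeg2 : a2 = 1 → 2 * k2 ≤ k1 ∧ k1 ≤ (a1 - 2) * k2)
    (x : ℤ → ℤ) (hx : XPlusMem a1 a2 x)
    (hxp : ∀ m : ℤ, 1 ≤ m → x m ≤ pseq a1 a2 k1 k2 m)
    (k : ℤ) (hk : 1 ≤ k) :
    (∀ l : ℤ, 1 ≤ l →
        cseq' a1 a2 (2 * l + idx k).toNat * (x (k + 1) - pseq a1 a2 k1 k2 (k + 1)) -
          cseq' a1 a2 (2 * l + idx k - 1).toNat * (x k - pseq a1 a2 k1 k2 k) ≤ 0) ↔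
      0 ≤ gammaR a1 a2 (k + 1) * (pseq a1 a2 k1 k2 (k + 1) : ℝ) - (pseq a1 a2 k1 k2 k : ℝ) +
          (x k : ℝ) - gammaR a1 a2 (k + 1) * (x (k + 1) : ℝ) := by
  have hy : (0 : ℝ) ≤ pseq a1 a2 k1 k2 (k + 1) - x (k + 1) := by
    exact_mod_cast sub_nonneg.2 (hxp (k + 1) (by omega))
  have hq := one_lt_alphaR_mul_betaR ha1 ha2 ha
  have hα := alphaR_pos ha2 ha
  rcases Int.emod_two_eq_zero_or_one k with hpar | hpar
  · have hi : idx k = 2 := by simp [idx, hpar]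
    have hγ : gammaR a1 a2 (k + 1) = betaR a1 a2 := by
      rw [gammaR, if_neg (by omega)]
    have key := forall_mul_le_iff_of_geometric (z := pseq a1 a2 k1 k2 k - x k) hq hα one_pos
      (fun m => (pow_mul_cseq'_sub ha1 ha2 ha m).2)
      (fun m _ => by simpa using (pow_le_cseq' ha1 ha2 ha m).1) hy
    rw [hγ, hi]
    refine Iff.trans ⟨fun h m hm => ?_, fun h l hl => ?_⟩
      (key.trans ⟨fun h => by linarith, fun h => by linarith⟩)
    · have hl := h m (by omega)
      rw [show (2 * (m : ℤ) + 2).toNat = 2 * m + 2 by omega,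
        show (2 * (m : ℤ) + 2 - 1).toNat = 2 * m + 1 by omega, ← Int.cast_nonpos (R := ℝ)] at hl
      push_cast at hl
      linarith
    · obtain ⟨m, rfl⟩ := Int.eq_ofNat_of_zero_le (by omega : 0 ≤ l)
      have hm := h m (by omega)
      rw [show (2 * (m : ℤ) + 2).toNat = 2 * m + 2 by omega,
        show (2 * (m : ℤ) + 2 - 1).toNat = 2 * m + 1 by omega, ← Int.cast_nonpos (R := ℝ)]
      push_cast
      linarith
  · have hi : idx k = 1 := by simp [idx, hpar]
    have hγ : gammaR a1 a2 (k + 1) = alphaR a1 a2 := by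
      rw [gammaR, if_pos (by omega)]
    have key := forall_mul_le_iff_of_geometric (z := pseq a1 a2 k1 k2 k - x k) hq one_pos hα
      (fun m => by simpa using (pow_mul_cseq'_sub ha1 ha2 ha m).1)
      (fun m hm => by
        obtain ⟨n, rfl⟩ := Nat.exists_eq_add_of_le' hm
        exact (pow_le_cseq' ha1 ha2 ha n).2) hy
    rw [hγ, hi]
    refine Iff.trans ⟨fun h m hm => ?_, fun h l hl => ?_⟩
      (key.trans ⟨fun h => by linarith, fun h => by linarith⟩)
    · have hl := h m (by omega)
      rw [show (2 * (m : ℤ) + 1).toNat = 2 * m + 1 by omega,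
        show (2 * (m : ℤ) + 1 - 1).toNat = 2 * m by omega, ← Int.cast_nonpos (R := ℝ)] at hl
      push_cast at hl
      linarith
    · obtain ⟨m, rfl⟩ := Int.eq_ofNat_of_zero_le (by omega : 0 ≤ l)
      have hm := h m (by omega)
      rw [show (2 * (m : ℤ) + 1).toNat = 2 * m + 1 by omega,
        show (2 * (m : ℤ) + 1 - 1).toNat = 2 * m by omega, ← Int.cast_nonpos (R := ℝ)]
      push_cast
      linarith
end

section
/- Let x̂ = (…, x_2, x_1) ∈ X+ be such that x_m ≤ p_m for all m ≥ 1. Then: (1) γ_k·x_k − x_{k+1} ≥ 0 for all k ≥ 1 if and only if ε_{i_j}( f̃_{i_{j+1}}^{p_{j+1}} ⋯ f̃_{i_{−1}}^{p_{−1}} f̃_{i_0}^{p_0} (x̂*) ) = 0 for all j ≤ 0; (2) γ_{k+1}·p_{k+1} − p_k + x_k − γ_{k+1}·x_{k+1} ≥ 0 for all k ≥ 1 if and only if φ_{i_j}( ẽ_{i_{j−1}}^{p_{j−1}−x_{j−1}} ⋯ ẽ_{i_2}^{p_2−x_2} ẽ_{i_1}^{p_1−x_1}(z_{−∞}) ) =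 0 for all j ≥ 1. -/
open Filter Function

namespace HypCrystal

/-- `x` vanishes at all sufficiently large positions. -/
def BddSupp (x : ℤ → ℤ) : Prop := ∃ N : ℤ, ∀ k : ℤ, N < k → x k = 0

/-- `ε_i` computed from the positions `k ≥ s` only. -/
noncomputable def epsFrom (a1 a2 s : ℤ) (x : ℤ → ℤ) (i : ℤ) : ℤ :=
  sSup {v : ℤ | ∃ k : ℤ, s ≤ k ∧ idx k = i ∧ sigmaP a1 a2 x k = v}

/-- The first position `k ≥ s` at which `ε_i` is attained. -/
noncomputable def kminFrom (a1 a2 s : ℤ) (x : ℤ → ℤ) (i : ℤ) : ℤ :=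
  sInf {k : ℤ | s ≤ k ∧ idx k = i ∧ sigmaP a1 a2 x k = epsFrom a1 a2 s x i}

/-- `f̃_i` acting on the positions `k ≥ s`. -/
noncomputable def fFrom (a1 a2 s i : ℤ) (x : ℤ → ℤ) : ℤ → ℤ :=
  Function.update x (kminFrom a1 a2 s x i) (x (kminFrom a1 a2 s x i) + 1)

variable {a1 a2 : ℤ}

lemma idx_isI (k : ℤ) : IsI (idx k) := by
  unfold IsI idx; split_ifs <;> simp

lemma idx_eq_idx_iff {j k : ℤ} : idx j = idx k ↔ j % 2 = k % 2 := by
  unfold idx; split_ifs <;> omega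

lemma exists_idx_ge {i : ℤ} (hi : IsI i) (n : ℤ) : ∃ k, n ≤ k ∧ k ≤ n + 1 ∧ idx k = i := by
  by_cases h : idx n = i
  · exact ⟨n, by lia, by lia, h⟩
  · refine ⟨n + 1, by lia, by lia, ?_⟩
    unfold idx IsI at *
    split_ifs at * <;> omega

lemma finite_support_sigma {x : ℤ → ℤ} (hx : BddSupp x) (k : ℤ) (c : ℤ → ℤ) :
    (Function.support fun j : ℤ => if k < j then c j * x j else 0).Finite := by
  obtain ⟨N, hN⟩ := hx
  refine (Set.finite_Icc k N).subset fun j hj => ?_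
  simp only [Function.mem_support, ne_eq, ite_eq_right_iff, Classical.not_imp] at hj
  refine ⟨hj.1.le, ?_⟩
  by_contra h
  exact hj.2 (by rw [hN j (by lia), mul_zero])

lemma sigmaP_congr {x y : ℤ → ℤ} {k : ℤ} (h : ∀ j, k ≤ j → x j = y j) :
    sigmaP a1 a2 x k = sigmaP a1 a2 y k := by
  unfold sigmaP
  rw [h k le_rfl]
  congr 1
  refine finsum_congr fun j => ?_
  split_ifs with hj
  · rw [h j hj.le]
  · rfl

lemma sigmaP_eq_zero {x : ℤ → ℤ} {k : ℤ} (h : ∀ j, k ≤ j → x j = 0) :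
    sigmaP a1 a2 x k = 0 := by
  rw [sigmaP_congr (y := fun _ => 0) h]
  simp [sigmaP]

lemma sigmaP_update {x : ℤ → ℤ} (hx : BddSupp x) (k v j : ℤ) :
    sigmaP a1 a2 (Function.update x k (x k + v)) j =
      sigmaP a1 a2 x j + if j = k then v else if j < k then pairJK a1 a2 k j * v else 0 := by
  have hfun : Function.update x k (x k + v) = fun l => x l + if l = k then v else 0 := by
    funext l
    by_cases hl : l = k
    · subst hl; simp
    · simp [hl]
  have hs : BddSupp fun l => if l = k then v else 0 :=
    ⟨k, fun l hl => if_neg (by lia)⟩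
  have hsum : (∑ᶠ l : ℤ, if j < l then pairJK a1 a2 l j * (x l + if l = k then v else 0) else 0) =
      (∑ᶠ l : ℤ, if j < l then pairJK a1 a2 l j * x l else 0) +
        ∑ᶠ l : ℤ, if j < l then pairJK a1 a2 l j * (if l = k then v else 0) else 0 := by
    rw [← finsum_add_distrib (finite_support_sigma hx j _) (finite_support_sigma hs j _)]
    refine finsum_congr fun l => ?_
    split_ifs <;> ring
  have hsingle : (∑ᶠ l : ℤ, if j < l then pairJK a1 a2 l j * (if l = k then v else 0) else 0) =
      if j < k then pairJK a1 a2 k j * v else 0 := by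
    rw [finsum_eq_single _ k fun l hl => by simp [hl]]
    simp
  rw [hfun]
  unfold sigmaP
  rw [hsum, hsingle]
  split_ifs <;> lia

lemma BddSupp.update {x : ℤ → ℤ} (hx : BddSupp x) (k v : ℤ) :
    BddSupp (Function.update x k v) := by
  obtain ⟨N, hN⟩ := hx
  refine ⟨max N k, fun l hl => ?_⟩
  rw [Function.update_of_ne (by lia), hN l (by lia)]

lemma BddSupp.fFrom {x : ℤ → ℤ} (hx : BddSupp x) (s i : ℤ) : BddSupp (fFrom a1 a2 s i x) :=
  hx.update _ _

lemma BddSupp.iterate_fFrom {x : ℤ → ℤ} (hx : BddSupp x) (s i : ℤ) (n : ℕ) :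
    BddSupp ((HypCrystal.fFrom a1 a2 s i)^[n] x) := by
  induction n with
  | zero => exact hx
  | succ n ih => rw [Function.iterate_succ_apply']; exact ih.fFrom s i

lemma exists_isGreatest_sigma {x : ℤ → ℤ} (hx : BddSupp x) (s : ℤ) {i : ℤ} (hi : IsI i) :
    ∃ v, IsGreatest {v : ℤ | ∃ k : ℤ, s ≤ k ∧ idx k = i ∧ sigmaP a1 a2 x k = v} v := by
  obtain ⟨N, hN⟩ := hx
  obtain ⟨k₁, h₁, h₂, h₃⟩ := exists_idx_ge hi (max s (N + 1))
  obtain ⟨k₀, hk₀, hmax⟩ := Finset.exists_max_image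
    ((Finset.Icc s k₁).filter fun k => idx k = i) (sigmaP a1 a2 x)
    ⟨k₁, by simp only [Finset.mem_filter, Finset.mem_Icc]; exact ⟨⟨by lia, le_rfl⟩, h₃⟩⟩
  simp only [Finset.mem_filter, Finset.mem_Icc] at hk₀ hmax
  refine ⟨_, ⟨k₀, hk₀.1.1, hk₀.2, rfl⟩, ?_⟩
  rintro _ ⟨k, hk, hki, rfl⟩
  by_cases hkk : k ≤ k₁
  · exact hmax k ⟨⟨hk, hkk⟩, hki⟩
  · have h0 : sigmaP a1 a2 x k₁ = 0 := sigmaP_eq_zero fun j hj => hN j (by lia)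
    have h0' : sigmaP a1 a2 x k = 0 := sigmaP_eq_zero fun j hj => hN j (by lia)
    rw [h0', ← h0]
    exact hmax k₁ ⟨⟨by lia, le_rfl⟩, h₃⟩

lemma isGreatest_epsFrom {x : ℤ → ℤ} (hx : BddSupp x) (s : ℤ) {i : ℤ} (hi : IsI i) :
    IsGreatest {v : ℤ | ∃ k : ℤ, s ≤ k ∧ idx k = i ∧ sigmaP a1 a2 x k = v}
      (epsFrom a1 a2 s x i) := by
  obtain ⟨v, hv⟩ := exists_isGreatest_sigma (a1 := a1) (a2 := a2) hx s hi
  unfold epsFrom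
  rwa [hv.csSup_eq]

lemma sigmaP_le_epsFrom {x : ℤ → ℤ} (hx : BddSupp x) {s k i : ℤ} (hk : s ≤ k) (hi : idx k = i) :
    sigmaP a1 a2 x k ≤ epsFrom a1 a2 s x i :=
  (isGreatest_epsFrom hx s (hi ▸ idx_isI k)).2 ⟨k, hk, hi, rfl⟩

lemma exists_sigmaP_eq_epsFrom {x : ℤ → ℤ} (hx : BddSupp x) (s : ℤ) {i : ℤ} (hi : IsI i) :
    ∃ k, s ≤ k ∧ idx k = i ∧ sigmaP a1 a2 x k = epsFrom a1 a2 s x i :=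
  (isGreatest_epsFrom hx s hi).1

lemma epsFrom_nonneg {x : ℤ → ℤ} (hx : BddSupp x) (s : ℤ) {i : ℤ} (hi : IsI i) :
    0 ≤ epsFrom a1 a2 s x i := by
  obtain ⟨N, hN⟩ := id hx
  obtain ⟨k, h₁, _, h₃⟩ := exists_idx_ge hi (max s (N + 1))
  rw [← sigmaP_eq_zero (a1 := a1) (a2 := a2) (x := x) (k := k) fun j hj => hN j (by lia)]
  exact sigmaP_le_epsFrom hx (by lia) h₃

lemma epsFrom_zero (s : ℤ) {i : ℤ} (hi : IsI i) : epsFrom a1 a2 s (fun _ => 0) i = 0 := by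
  obtain ⟨k, _, _, hk⟩ := exists_sigmaP_eq_epsFrom (a1 := a1) (a2 := a2) (x := fun _ => 0)
    ⟨0, fun _ _ => rfl⟩ s hi
  rw [← hk, sigmaP_eq_zero fun _ _ => rfl]

lemma isLeast_kminFrom {x : ℤ → ℤ} (hx : BddSupp x) (s : ℤ) {i : ℤ} (hi : IsI i) :
    IsLeast {k : ℤ | s ≤ k ∧ idx k = i ∧ sigmaP a1 a2 x k = epsFrom a1 a2 s x i}
      (kminFrom a1 a2 s x i) :=
  ⟨Int.csInf_mem (exists_sigmaP_eq_epsFrom hx s hi) ⟨s, fun _ h => h.1⟩,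
    fun _ h => csInf_le ⟨s, fun _ h => h.1⟩ h⟩

lemma epsFrom_congr {x y : ℤ → ℤ} {s : ℤ} (h : ∀ k, s ≤ k → x k = y k) (i : ℤ) :
    epsFrom a1 a2 s x i = epsFrom a1 a2 s y i := by
  unfold epsFrom
  congr 1
  ext v
  refine exists_congr fun k => and_congr_right fun hk => ?_
  rw [sigmaP_congr fun j hj => h j (hk.trans hj)]

lemma kminFrom_congr {x y : ℤ → ℤ} {s : ℤ} (h : ∀ k, s ≤ k → x k = y k) (i : ℤ) :
    kminFrom a1 a2 s x i = kminFrom a1 a2 s y i := by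
  unfold kminFrom
  congr 1
  ext k
  refine and_congr_right fun hk => ?_
  rw [sigmaP_congr fun j hj => h j (hk.trans hj), epsFrom_congr h]

lemma fFrom_congr {x y : ℤ → ℤ} (hx : BddSupp x) {s i : ℤ} (hi : IsI i)
    (h : ∀ k, s ≤ k → x k = y k) (k : ℤ) (hk : s ≤ k) :
    fFrom a1 a2 s i x k = fFrom a1 a2 s i y k := by
  unfold fFrom
  rw [← kminFrom_congr h]
  have hm := (isLeast_kminFrom (a1 := a1) (a2 := a2) hx s hi).1.1
  by_cases hkk : k = kminFrom a1 a2 s x i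
  · rw [← hkk]; simp [h k hk]
  · simp [hkk, h k hk]

lemma iterate_fFrom_congr {x y : ℤ → ℤ} (hx : BddSupp x) {s i : ℤ} (hi : IsI i)
    (h : ∀ k, s ≤ k → x k = y k) (n : ℕ) :
    ∀ k, s ≤ k → (fFrom a1 a2 s i)^[n] x k = (fFrom a1 a2 s i)^[n] y k := by
  induction n with
  | zero => exact h
  | succ n ih =>
    simp only [Function.iterate_succ_apply']
    exact fFrom_congr (hx.iterate_fFrom s i n) hi ih

lemma epsFrom_of_idx_ne {x : ℤ → ℤ} {s i : ℤ} (hs : idx s ≠ i) :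
    epsFrom a1 a2 s x i = epsFrom a1 a2 (s + 1) x i := by
  unfold epsFrom
  congr 1
  ext v
  refine exists_congr fun k => ⟨fun ⟨h, h', h''⟩ => ⟨?_, h', h''⟩, fun ⟨h, h', h''⟩ =>
    ⟨by lia, h', h''⟩⟩
  rcases h.eq_or_lt with rfl | h
  · exact absurd h' hs
  · exact h

lemma epsFrom_of_idx_eq {x : ℤ → ℤ} (hx : BddSupp x) {s i : ℤ} (hs : idx s = i) :
    epsFrom a1 a2 s x i = max (epsFrom a1 a2 (s + 1) x i) (sigmaP a1 a2 x s) := by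
  have hi : IsI i := hs ▸ idx_isI s
  apply le_antisymm
  · obtain ⟨k, hk, hki, hkv⟩ := exists_sigmaP_eq_epsFrom (a1 := a1) (a2 := a2) hx s hi
    rw [← hkv]
    rcases hk.eq_or_lt with rfl | hk
    · exact le_max_right _ _
    · exact le_max_of_le_left (sigmaP_le_epsFrom hx hk hki)
  · obtain ⟨k, hk, hki, hkv⟩ := exists_sigmaP_eq_epsFrom (a1 := a1) (a2 := a2) hx (s + 1) hi
    rw [← hkv]
    exact max_le (sigmaP_le_epsFrom hx (by lia) hki) (sigmaP_le_epsFrom hx le_rfl hs)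

lemma fFrom_of_idx_ne {x : ℤ → ℤ} {s i : ℤ} (hs : idx s ≠ i) :
    fFrom a1 a2 s i x = fFrom a1 a2 (s + 1) i x := by
  have h : kminFrom a1 a2 s x i = kminFrom a1 a2 (s + 1) x i := by
    unfold kminFrom
    rw [epsFrom_of_idx_ne hs]
    congr 1
    ext k
    refine ⟨fun ⟨h, h', h''⟩ => ⟨?_, h', h''⟩, fun ⟨h, h', h''⟩ => ⟨by lia, h', h''⟩⟩
    rcases h.eq_or_lt with rfl | h
    · exact absurd h' hs
    · exact h
  unfold fFrom
  rw [h]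

lemma fFrom_of_sigmaP_lt {x : ℤ → ℤ} (hx : BddSupp x) {s i : ℤ} (hs : idx s = i)
    (hlt : sigmaP a1 a2 x s < epsFrom a1 a2 (s + 1) x i) :
    fFrom a1 a2 s i x = fFrom a1 a2 (s + 1) i x := by
  have he : epsFrom a1 a2 s x i = epsFrom a1 a2 (s + 1) x i := by
    rw [epsFrom_of_idx_eq hx hs, max_eq_left hlt.le]
  have h : kminFrom a1 a2 s x i = kminFrom a1 a2 (s + 1) x i := by
    unfold kminFrom
    rw [he]
    congr 1
    ext k
    refine ⟨fun ⟨h, h', h''⟩ => ⟨?_, h', h''⟩, fun ⟨h, h', h''⟩ => ⟨by lia, h', h''⟩⟩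
    rcases h.eq_or_lt with rfl | h
    · exact absurd h'' hlt.ne
    · exact h
  unfold fFrom
  rw [h]

lemma fFrom_of_le_sigmaP {x : ℤ → ℤ} (hx : BddSupp x) {s i : ℤ} (hs : idx s = i)
    (hle : epsFrom a1 a2 (s + 1) x i ≤ sigmaP a1 a2 x s) :
    fFrom a1 a2 s i x = Function.update x s (x s + 1) := by
  have he : sigmaP a1 a2 x s = epsFrom a1 a2 s x i := by
    rw [epsFrom_of_idx_eq hx hs, max_eq_right hle]
  have hl := isLeast_kminFrom (a1 := a1) (a2 := a2) hx s (hs ▸ idx_isI s : IsI i)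
  have h : kminFrom a1 a2 s x i = s := le_antisymm (hl.2 ⟨le_rfl, hs, he⟩) hl.1.1
  unfold fFrom
  rw [h]

lemma epsFrom_fFrom {x : ℤ → ℤ} (hx : BddSupp x) {s i : ℤ} (hi : IsI i) :
    epsFrom a1 a2 s (fFrom a1 a2 s i x) i = epsFrom a1 a2 s x i + 1 := by
  have hl := isLeast_kminFrom (a1 := a1) (a2 := a2) hx s hi
  obtain ⟨⟨hk, hki, hkv⟩, hmin⟩ := hl
  have hσ : ∀ j, sigmaP a1 a2 (fFrom a1 a2 s i x) j = _ :=
    fun j => sigmaP_update hx (kminFrom a1 a2 s x i) 1 j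
  apply le_antisymm
  · obtain ⟨j, hj, hji, hjv⟩ :=
      exists_sigmaP_eq_epsFrom (a1 := a1) (a2 := a2) (hx.fFrom (a1 := a1) (a2 := a2) s i) s hi
    rw [← hjv, hσ]
    have hle := sigmaP_le_epsFrom (a1 := a1) (a2 := a2) hx hj hji
    split_ifs with h₁ h₂
    · lia
    · have hne : sigmaP a1 a2 x j ≠ epsFrom a1 a2 s x i := fun h =>
        absurd (hmin ⟨hj, hji, h⟩) (by lia)
      have hp : pairJK a1 a2 (kminFrom a1 a2 s x i) j = 2 := by
        unfold pairJK
        rw [if_pos (idx_eq_idx_iff.1 (hki.trans hji.symm))]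
      rw [hp]
      lia
    · lia
  · have := sigmaP_le_epsFrom (a1 := a1) (a2 := a2) (hx.fFrom (a1 := a1) (a2 := a2) s i) hk hki
    rw [hσ, if_pos rfl, hkv] at this
    exact this

/-- The state reached from `0` by the steps `f̃_{i_{e+m}}^{Y m}`, `m < n`, on the positions `≥ s`. -/
noncomputable def chainFrom (a1 a2 s e : ℤ) (Y : ℕ → ℤ) : ℕ → ℤ → ℤ
  | 0 => fun _ => 0
  | n + 1 => (fFrom a1 a2 s (idx (e + n)))^[(Y n).toNat] (chainFrom a1 a2 s e Y n)

/-- The value of `-σ_s` along `chainFrom`, as long as `ε` vanishes. -/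
def gap (a1 a2 s e : ℤ) (Y : ℕ → ℤ) : ℕ → ℤ
  | 0 => 0
  | n + 1 =>
    if idx (e + n) = idx s then
      gap a1 a2 s e Y n - Y n - min (Y n) (gap a1 a2 s e Y n)
    else gap a1 a2 s e Y n + aIdx a1 a2 s * Y n

/-- The exponents of the part of `chainFrom` acting on the positions `≥ s + 1`. -/
def peel (a1 a2 s e : ℤ) (Y : ℕ → ℤ) (n : ℕ) : ℤ :=
  if idx (e + n) = idx s then min (Y n) (gap a1 a2 s e Y n) else Y n

lemma bddSupp_chainFrom (s e : ℤ) (Y : ℕ → ℤ) (n : ℕ) : BddSupp (chainFrom a1 a2 s e Y n) := by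
  induction n with
  | zero => exact ⟨0, fun _ _ => rfl⟩
  | succ n ih => exact ih.iterate_fFrom _ _ _

lemma sigmaP_fFrom_succ {x : ℤ → ℤ} (hx : BddSupp x) {s i : ℤ} (hi : IsI i) :
    sigmaP a1 a2 (fFrom a1 a2 (s + 1) i x) s =
      sigmaP a1 a2 x s + if i = idx s then 2 else - aIdx a1 a2 s := by
  obtain ⟨⟨hk, hki, -⟩, -⟩ := isLeast_kminFrom (a1 := a1) (a2 := a2) hx (s + 1) hi
  have h := sigmaP_update (a1 := a1) (a2 := a2) hx (kminFrom a1 a2 (s + 1) x i) 1 s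
  rw [if_neg (by lia), if_pos (by lia), mul_one] at h
  refine h.trans ?_
  congr 1
  unfold pairJK aIdx
  simp only [← idx_eq_idx_iff, hki]
  split_ifs <;> rfl

lemma iterate_fFrom_succ_of_idx_ne {x : ℤ → ℤ} (hx : BddSupp x) {s i : ℤ} (hi : IsI i)
    (hs : idx s ≠ i) (n : ℕ) :
    (fFrom a1 a2 s i)^[n] x = (fFrom a1 a2 (s + 1) i)^[n] x ∧
      sigmaP a1 a2 ((fFrom a1 a2 s i)^[n] x) s = sigmaP a1 a2 x s - aIdx a1 a2 s * n := by
  induction n with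
  | zero => simp
  | succ n ih =>
    simp only [Function.iterate_succ_apply']
    rw [fFrom_of_idx_ne hs, sigmaP_fFrom_succ (hx.iterate_fFrom _ _ _) hi, if_neg (Ne.symm hs),
      ih.2, ih.1]
    exact ⟨rfl, by push_cast; ring⟩

lemma iterate_fFrom_of_le_gap {x : ℤ → ℤ} (hx : BddSupp x) {s i : ℤ} (hs : idx s = i)
    (he : epsFrom a1 a2 (s + 1) x i = 0) (n : ℕ) (hn : (n : ℤ) ≤ - sigmaP a1 a2 x s) :
    (fFrom a1 a2 s i)^[n] x = (fFrom a1 a2 (s + 1) i)^[n] x ∧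
      sigmaP a1 a2 ((fFrom a1 a2 s i)^[n] x) s = sigmaP a1 a2 x s + 2 * n ∧
      epsFrom a1 a2 (s + 1) ((fFrom a1 a2 s i)^[n] x) i = n := by
  have hi : IsI i := hs ▸ idx_isI s
  induction n with
  | zero => simpa using he
  | succ n ih =>
    push_cast at hn
    obtain ⟨h₁, h₂, h₃⟩ := ih (by lia)
    have hb := hx.iterate_fFrom (a1 := a1) (a2 := a2) s i n
    simp only [Function.iterate_succ_apply']
    rw [fFrom_of_sigmaP_lt hb hs (by lia), sigmaP_fFrom_succ hb hi, if_pos hs.symm, h₂,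
      epsFrom_fFrom hb hi, h₃, h₁]
    exact ⟨rfl, by push_cast; ring, by push_cast; ring⟩

lemma iterate_fFrom_of_le_sigmaP {x : ℤ → ℤ} (hx : BddSupp x) {s i : ℤ} (hs : idx s = i)
    (hle : epsFrom a1 a2 (s + 1) x i ≤ sigmaP a1 a2 x s) (n : ℕ) :
    (∀ k, s + 1 ≤ k → (fFrom a1 a2 s i)^[n] x k = x k) ∧
      sigmaP a1 a2 ((fFrom a1 a2 s i)^[n] x) s = sigmaP a1 a2 x s + n := by
  induction n with
  | zero => simp
  | succ n ih =>
    have hb := hx.iterate_fFrom (a1 := a1) (a2 := a2) s i n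
    have he := epsFrom_congr (a1 := a1) (a2 := a2) ih.1 i
    simp only [Function.iterate_succ_apply']
    rw [fFrom_of_le_sigmaP hb hs (by lia)]
    refine ⟨fun k hk => ?_, ?_⟩
    · rw [Function.update_of_ne (by lia), ih.1 k hk]
    · rw [sigmaP_update hb, if_pos rfl, ih.2]
      push_cast; ring

lemma iterate_fFrom_of_idx_eq {x : ℤ → ℤ} (hx : BddSupp x) {s i : ℤ} (hs : idx s = i)
    (he : epsFrom a1 a2 (s + 1) x i = 0) {G Y : ℤ} (hσ : sigmaP a1 a2 x s = -G) (hG : 0 ≤ G)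
    (hY : 0 ≤ Y) :
    (∀ k, s + 1 ≤ k → (fFrom a1 a2 s i)^[Y.toNat] x k =
        (fFrom a1 a2 (s + 1) i)^[(min Y G).toNat] x k) ∧
      sigmaP a1 a2 ((fFrom a1 a2 s i)^[Y.toNat] x) s = -(G - Y - min Y G) := by
  obtain ⟨m, hm⟩ := Int.eq_ofNat_of_zero_le (le_min hY hG)
  obtain ⟨r, hr⟩ := Int.eq_ofNat_of_zero_le (sub_nonneg.2 (min_le_left Y G))
  obtain ⟨h₁, h₂, h₃⟩ := iterate_fFrom_of_le_gap hx hs he m (by lia)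
  have hYm : Y.toNat = r + m := by lia
  have hmm : (min Y G).toNat = m := by lia
  rw [hYm, hmm, Function.iterate_add_apply]
  by_cases hle : Y ≤ G
  · have hr0 : r = 0 := by lia
    subst hr0
    rw [Function.iterate_zero_apply, h₂, h₁]
    exact ⟨fun _ _ => rfl, by lia⟩
  · obtain ⟨h₄, h₅⟩ := iterate_fFrom_of_le_sigmaP (a1 := a1) (a2 := a2)
      (hx.iterate_fFrom (a1 := a1) (a2 := a2) s i m) hs (by lia) r
    rw [h₅, h₂]
    refine ⟨fun k hk => ?_, by lia⟩
    rw [h₄ k hk, h₁]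

lemma chainFrom_agree_of_vanish {s e : ℤ} {Y : ℕ → ℤ} {n : ℕ} (hY : ∀ m < n, 0 ≤ Y m)
    (h : ∀ m < n, epsFrom a1 a2 (s + 1) (chainFrom a1 a2 (s + 1) e (peel a1 a2 s e Y) m)
      (idx (e + m)) = 0 ∧ (idx (e + m) = idx s → 0 ≤ gap a1 a2 s e Y m)) :
    (∀ k, s + 1 ≤ k → chainFrom a1 a2 s e Y n k =
        chainFrom a1 a2 (s + 1) e (peel a1 a2 s e Y) n k) ∧
      sigmaP a1 a2 (chainFrom a1 a2 s e Y n) s = - gap a1 a2 s e Y n := by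
  induction n with
  | zero =>
    refine ⟨fun _ _ => rfl, ?_⟩
    rw [chainFrom, gap, neg_zero]
    exact sigmaP_eq_zero fun _ _ => rfl
  | succ n ih =>
    obtain ⟨hag, hσ⟩ := ih (fun m hm => hY m (by lia)) fun m hm => h m (by lia)
    have hb := bddSupp_chainFrom (a1 := a1) (a2 := a2) s e Y n
    obtain ⟨hv, hg⟩ := h n (by lia)
    have hi := idx_isI (e + n)
    have hYn := hY n (by lia)
    rw [← epsFrom_congr hag] at hv
    simp only [chainFrom, gap, peel]
    by_cases hs : idx (e + n) = idx s
    · obtain ⟨h₁, h₂⟩ := iterate_fFrom_of_idx_eq hb hs.symm hv hσ (hg hs) hYn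
      rw [if_pos hs, if_pos hs, h₂]
      refine ⟨fun k hk => ?_, rfl⟩
      rw [h₁ k hk]
      exact iterate_fFrom_congr hb hi hag _ k hk
    · obtain ⟨h₁, h₂⟩ := iterate_fFrom_succ_of_idx_ne (a1 := a1) (a2 := a2) hb hi (Ne.symm hs)
        (Y n).toNat
      rw [if_neg hs, if_neg hs, h₂, hσ, h₁, Int.toNat_of_nonneg hYn]
      exact ⟨iterate_fFrom_congr hb hi hag _, by ring⟩

lemma vanish_iff_peel {s e : ℤ} {Y : ℕ → ℤ} {M : ℕ} (hY : ∀ m < M, 0 ≤ Y m) :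
    (∀ n < M, epsFrom a1 a2 s (chainFrom a1 a2 s e Y n) (idx (e + n)) = 0) ↔
      ∀ n < M, epsFrom a1 a2 (s + 1) (chainFrom a1 a2 (s + 1) e (peel a1 a2 s e Y) n)
        (idx (e + n)) = 0 ∧ (idx (e + n) = idx s → 0 ≤ gap a1 a2 s e Y n) := by
  have key : ∀ n < M, (∀ m < n, epsFrom a1 a2 (s + 1)
      (chainFrom a1 a2 (s + 1) e (peel a1 a2 s e Y) m)
        (idx (e + m)) = 0 ∧ (idx (e + m) = idx s → 0 ≤ gap a1 a2 s e Y m)) →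
      (epsFrom a1 a2 s (chainFrom a1 a2 s e Y n) (idx (e + n)) = 0 ↔
        epsFrom a1 a2 (s + 1) (chainFrom a1 a2 (s + 1) e (peel a1 a2 s e Y) n)
          (idx (e + n)) = 0 ∧ (idx (e + n) = idx s → 0 ≤ gap a1 a2 s e Y n)) := by
    intro n hn h
    obtain ⟨hag, hσ⟩ := chainFrom_agree_of_vanish (fun m hm => hY m (by lia)) h
    have hb := bddSupp_chainFrom (a1 := a1) (a2 := a2) s e Y n
    have h0 := epsFrom_nonneg (a1 := a1) (a2 := a2) hb (s + 1) (idx_isI (e + n))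
    rw [← epsFrom_congr hag]
    by_cases hs : idx (e + n) = idx s
    · rw [epsFrom_of_idx_eq hb hs.symm, hσ]
      simp only [hs, true_implies] at h0 ⊢
      lia
    · rw [epsFrom_of_idx_ne (Ne.symm hs)]
      simp [hs]
  constructor
  · intro h n
    induction n using Nat.strong_induction_on with
    | _ n ih => exact fun hn => (key n hn fun m hm => ih m hm (by lia)).1 (h n hn)
  · exact fun h n hn => (key n hn fun m hm => h m (by lia)).2 (h n hn)

lemma aIdx_congr {j k : ℤ} (h : idx j = idx k) : aIdx a1 a2 j = aIdx a1 a2 k := by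
  unfold aIdx
  rw [idx_eq_idx_iff.1 h]

lemma idx_add_two (k : ℤ) : idx (k + 2) = idx k := idx_eq_idx_iff.2 (by lia)

lemma idx_eq_of_idx_succ_ne {k s : ℤ} (h : idx (k + 1) ≠ idx s) : idx k = idx s := by
  rw [Ne, idx_eq_idx_iff] at h
  exact idx_eq_idx_iff.2 (by lia)

lemma idx_succ_ne {k s : ℤ} (h : idx k = idx s) : idx (k + 1) ≠ idx s := by
  rw [idx_eq_idx_iff] at h
  rw [Ne, idx_eq_idx_iff]
  lia

lemma gap_add_two {s e : ℤ} {Y : ℕ → ℤ} {n : ℕ} (h : idx (e + n) = idx s) :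
    gap a1 a2 s e Y (n + 2) = gap a1 a2 s e Y n - Y n - min (Y n) (gap a1 a2 s e Y n) +
      aIdx a1 a2 s * Y (n + 1) := by
  rw [gap, if_neg, gap, if_pos h]
  push_cast
  rw [← add_assoc]
  exact idx_succ_ne h

/-- `κ n = c_{M-n}` for the `c`-sequence starting at step `M - 1`. -/
structure IsConeCoeff (a1 a2 e : ℤ) (M : ℕ) (κ : ℕ → ℤ) : Prop where
  eq_zero : κ M = 0
  pos : ∀ n < M, 0 < κ n
  recurrence : ∀ n, n + 1 < M → κ n = aIdx a1 a2 (e + n + 1) * κ (n + 1) - κ (n + 2)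

lemma IsConeCoeff.nonneg {e : ℤ} {M : ℕ} {κ : ℕ → ℤ} (hκ : IsConeCoeff a1 a2 e M κ) {n : ℕ}
    (hn : n ≤ M) : 0 ≤ κ n := by
  rcases hn.eq_or_lt with rfl | hn
  · exact hκ.eq_zero.ge
  · exact (hκ.pos n hn).le

lemma peel_le {s e : ℤ} {Y : ℕ → ℤ} (n : ℕ) : peel a1 a2 s e Y n ≤ Y n := by
  unfold peel
  split_ifs
  · exact min_le_left _ _
  · exact le_rfl

lemma cone_iff_peel {s e : ℤ} {Y κ : ℕ → ℤ} {M : ℕ}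
    (hκ : IsConeCoeff a1 a2 e M κ) (hY : ∀ m < M, 0 ≤ Y m) :
    (∀ n, n + 1 < M → κ (n + 2) * Y n ≤ κ (n + 1) * Y (n + 1)) ↔
      (∀ n, n + 1 < M → κ (n + 2) * peel a1 a2 s e Y n ≤ κ (n + 1) * peel a1 a2 s e Y (n + 1)) ∧
        ∀ n < M, idx (e + n) = idx s → 0 ≤ gap a1 a2 s e Y n := by
  constructor
  · intro h
    have hgap : ∀ n, n + 1 < M → idx (e + n + 1) = idx s →
        κ (n + 2) * Y n ≤ κ (n + 1) * gap a1 a2 s e Y (n + 1) := by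
      intro n hn hs
      have hrec := hκ.recurrence n hn
      rw [aIdx_congr hs] at hrec
      rcases n with _ | n
      · have h1 : gap a1 a2 s e Y (0 + 1) = aIdx a1 a2 s * Y 0 := by
          rw [gap, if_neg, gap, zero_add]
          intro h'
          exact idx_succ_ne h' hs
        rw [h1]
        have := hκ.pos 0 (by lia)
        nlinarith [hY 0 (by lia)]
      · have hs' : idx (e + n) = idx s := by
          rw [← hs, ← idx_add_two]; congr 1; push_cast; ring
        rw [show n + 1 + 1 = n + 2 from rfl, gap_add_two hs']
        have hc := h n (by lia)
        have hp := hκ.pos (n + 2) hn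
        have hm := min_le_right (Y n) (gap a1 a2 s e Y n)
        have h2 : κ (n + 2) * min (Y n) (gap a1 a2 s e Y n) ≤
          κ (n + 2) * gap a1 a2 s e Y n := mul_le_mul_of_nonneg_left hm hp.le
        have h3 : κ (n + 1) * Y (n + 1) =
          (aIdx a1 a2 s * κ (n + 2) - κ (n + 3)) * Y (n + 1) := by rw [← hrec]
        show κ (n + 3) * Y (n + 1) ≤ _
        linarith
    refine ⟨fun n hn => ?_, fun n hn hs => ?_⟩
    · by_cases hs : idx (e + n + 1) = idx s
      · have e0 : peel a1 a2 s e Y n = Y n := by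
          unfold peel; rw [if_neg]; intro h'; exact idx_succ_ne h' hs
        have e1 : peel a1 a2 s e Y (n + 1) = min (Y (n + 1)) (gap a1 a2 s e Y (n + 1)) := by
          unfold peel; rw [if_pos]; push_cast; rw [← add_assoc]; exact hs
        rw [e0, e1, mul_min_of_nonneg _ _ (hκ.nonneg hn.le)]
        exact le_min (h n hn) (hgap n hn hs)
      · have e1 : peel a1 a2 s e Y (n + 1) = Y (n + 1) := by
          unfold peel; rw [if_neg]; push_cast; rw [← add_assoc]; exact hs
        rw [e1]
        exact (mul_le_mul_of_nonneg_left (peel_le n) (hκ.nonneg hn)).trans (h n hn)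
    · rcases n with _ | n
      · exact le_rfl
      · have h1 := hgap n hn (by rw [← hs]; push_cast; rw [add_assoc])
        have h2 := mul_nonneg (hκ.nonneg (n := n + 2) hn) (hY n (by lia))
        exact nonneg_of_mul_nonneg_right (h2.trans h1) (hκ.pos _ hn)
  · rintro ⟨h, hg⟩ n hn
    by_cases hs : idx (e + n + 1) = idx s
    · have e0 : peel a1 a2 s e Y n = Y n := by
        unfold peel; rw [if_neg]; intro h'; exact idx_succ_ne h' hs
      have h1 := h n hn
      rw [e0] at h1
      exact h1.trans (mul_le_mul_of_nonneg_left (peel_le _) (hκ.nonneg hn.le))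
    · have hs' := idx_eq_of_idx_succ_ne hs
      have e1 : peel a1 a2 s e Y (n + 1) = Y (n + 1) := by
        unfold peel; rw [if_neg]; push_cast; rw [← add_assoc]; exact hs
      have e0 : peel a1 a2 s e Y n = min (Y n) (gap a1 a2 s e Y n) := by
        unfold peel; rw [if_pos hs']
      rcases le_total (Y n) (gap a1 a2 s e Y n) with hYg | hYg
      · have h1 := h n hn
        rwa [e0, e1, min_eq_left hYg] at h1
      · rcases (Nat.succ_le_of_lt hn).eq_or_lt with hM | hM
        · have : κ (n + 2) = 0 := by rw [← hκ.eq_zero, ← hM]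
          rw [this, zero_mul]
          exact mul_nonneg (hκ.nonneg hn.le) (hY _ hn)
        · have h1 := h (n + 1) hM
          have hs2 : idx (e + (n + 2 : ℕ)) = idx s := by
            rw [← hs', ← idx_add_two (e + n)]; congr 1; push_cast; ring
          have e2 : peel a1 a2 s e Y (n + 2) ≤ gap a1 a2 s e Y (n + 2) := by
            unfold peel; rw [if_pos hs2]; exact min_le_right _ _
          rw [gap_add_two hs', min_eq_right hYg] at e2
          have hp := hκ.pos (n + 2) hM
          have h2 := mul_le_mul_of_nonneg_left e2 hp.le
          have hrec := hκ.recurrence (n + 1) hM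
          rw [aIdx_congr (k := s) (by rw [← hs2]; congr 1; push_cast; ring)] at hrec
          rw [e1] at h1
          have h3 : κ (n + 1) * Y (n + 1) =
            (aIdx a1 a2 s * κ (n + 2) - κ (n + 3)) * Y (n + 1) := by rw [hrec]
          have h4 : κ (n + 3) * Y (n + 1) ≤ κ (n + 2) * peel a1 a2 s e Y (n + 2) := h1
          linarith

lemma gap_eq_zero {s e : ℤ} {Y : ℕ → ℤ} {n : ℕ} (h : ∀ m < n, Y m = 0) :
    gap a1 a2 s e Y n = 0 := by
  induction n with
  | zero => rfl
  | succ n ih =>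
    rw [gap, ih fun m hm => h m (by lia), h n (by lia)]
    simp

lemma chainFrom_eq_zero {s e : ℤ} {Y : ℕ → ℤ} {n : ℕ} (h : ∀ m < n, Y m = 0) :
    chainFrom a1 a2 s e Y n = fun _ => 0 := by
  induction n with
  | zero => rfl
  | succ n ih =>
    rw [chainFrom, ih fun m hm => h m (by lia), h n (by lia)]
    rfl

/-- Both sides of the string cone criterion are compatible with peeling off the position `s`. -/
lemma vanish_iff_cone_of_peel {s e : ℤ} {Y κ : ℕ → ℤ} {M : ℕ} (hκ : IsConeCoeff a1 a2 e M κ)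
    (hY : ∀ m < M, 0 ≤ Y m)
    (h : (∀ n < M, 0 ≤ peel a1 a2 s e Y n) →
      ((∀ n < M, epsFrom a1 a2 (s + 1) (chainFrom a1 a2 (s + 1) e (peel a1 a2 s e Y) n)
        (idx (e + n)) = 0) ↔
      ∀ n, n + 1 < M → κ (n + 2) * peel a1 a2 s e Y n ≤ κ (n + 1) * peel a1 a2 s e Y (n + 1))) :
    (∀ n < M, epsFrom a1 a2 s (chainFrom a1 a2 s e Y n) (idx (e + n)) = 0) ↔
      ∀ n, n + 1 < M → κ (n + 2) * Y n ≤ κ (n + 1) * Y (n + 1) := by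
  rw [vanish_iff_peel hY, cone_iff_peel (s := s) hκ hY]
  have hpos : (∀ n < M, idx (e + n) = idx s → 0 ≤ gap a1 a2 s e Y n) →
      ∀ n < M, 0 ≤ peel a1 a2 s e Y n := by
    intro hg n hn
    unfold peel
    split_ifs with hs
    · exact le_min (hY n hn) (hg n hn hs)
    · exact hY n hn
  constructor
  · intro h'
    have hg : ∀ n < M, idx (e + n) = idx s → 0 ≤ gap a1 a2 s e Y n := fun n hn => (h' n hn).2
    exact ⟨(h (hpos hg)).1 fun n hn => (h' n hn).1, hg⟩
  · rintro ⟨hc, hg⟩ n hn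
    exact ⟨(h (hpos hg)).2 hc n hn, hg n hn⟩

/-- The string cone criterion: along a chain of `f̃`-powers the relevant `ε` vanish exactly when the
exponents satisfy the cone inequalities. -/
theorem vanish_iff_cone {e : ℤ} {κ : ℕ → ℤ} {M : ℕ} (hκ : IsConeCoeff a1 a2 e M κ) (s : ℤ)
    {Y : ℕ → ℤ} (hY : ∀ m < M, 0 ≤ Y m) :
    (∀ n < M, epsFrom a1 a2 s (chainFrom a1 a2 s e Y n) (idx (e + n)) = 0) ↔
      ∀ n, n + 1 < M → κ (n + 2) * Y n ≤ κ (n + 1) * Y (n + 1) := by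
  obtain ⟨S, hS⟩ : ∃ S : ℕ, ∑ n ∈ Finset.range M, Y n = S :=
    Int.eq_ofNat_of_zero_le (Finset.sum_nonneg fun n hn => hY n (Finset.mem_range.1 hn))
  induction S using Nat.strong_induction_on generalizing s Y with
  | _ S ih =>
    by_cases hex : ∃ n, n < M ∧ Y n ≠ 0
    · classical
      obtain ⟨hnM, hn0⟩ := Nat.find_spec hex
      have hbefore : ∀ m < Nat.find hex, Y m = 0 := fun m hm => by
        by_contra h
        exact Nat.find_min hex hm ⟨by lia, h⟩
      generalize Nat.find hex = n₀ at hnM hn0 hbefore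
      have hmatch : ∀ (s : ℤ) (Y : ℕ → ℤ), (∀ m < M, 0 ≤ Y m) → ∑ n ∈ Finset.range M, Y n = S →
          (∀ m < n₀, Y m = 0) → Y n₀ ≠ 0 → idx (e + n₀) = idx s →
          ((∀ n < M, epsFrom a1 a2 s (chainFrom a1 a2 s e Y n) (idx (e + n)) = 0) ↔
            ∀ n, n + 1 < M → κ (n + 2) * Y n ≤ κ (n + 1) * Y (n + 1)) := by
        intro s Y hY hS hb hn hs
        refine vanish_iff_cone_of_peel hκ hY fun hp => ?_
        have hlt : ∑ n ∈ Finset.range M, peel a1 a2 s e Y n < ∑ n ∈ Finset.range M, Y n := by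
          refine Finset.sum_lt_sum (fun n _ => peel_le n) ⟨n₀, Finset.mem_range.2 hnM, ?_⟩
          rw [peel, if_pos hs, gap_eq_zero hb]
          have := hY n₀ hnM
          lia
        obtain ⟨T, hT⟩ := Int.eq_ofNat_of_zero_le
          (Finset.sum_nonneg fun n hn => hp n (Finset.mem_range.1 hn))
        exact ih T (by lia) (s + 1) hp hT
      by_cases hs : idx (e + n₀) = idx s
      · exact hmatch s Y hY hS hbefore hn0 hs
      · refine vanish_iff_cone_of_peel hκ hY fun hp => ?_
        have hle : ∑ n ∈ Finset.range M, peel a1 a2 s e Y n ≤ ∑ n ∈ Finset.range M, Y n :=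
          Finset.sum_le_sum fun n _ => peel_le n
        obtain ⟨T, hT⟩ := Int.eq_ofNat_of_zero_le
          (Finset.sum_nonneg fun n hn => hp n (Finset.mem_range.1 hn))
        rcases (show T ≤ S by lia).eq_or_lt with rfl | hlt
        · refine hmatch (s + 1) _ hp hT (fun m hm => ?_) ?_ ?_
          · have := hp m (by lia)
            have := peel_le (a1 := a1) (a2 := a2) (s := s) (e := e) (Y := Y) m
            rw [hbefore m hm] at this
            lia
          · rwa [peel, if_neg hs]
          · rw [idx_eq_idx_iff] at hs ⊢
            lia
        · exact ih T hlt (s + 1) hp hT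
    · push Not at hex
      refine ⟨fun _ n hn => by simp [hex n (by lia), hex (n + 1) hn], fun _ n hn => ?_⟩
      rw [chainFrom_eq_zero fun m hm => hex m (by lia)]
      exact epsFrom_zero s (idx_isI _)

lemma gammaR_congr {j k : ℤ} (h : j % 2 = k % 2) : gammaR a1 a2 j = gammaR a1 a2 k := by
  unfold gammaR
  rw [h]

section Hyperbolic

lemma alphaR_betaR_relations (ha1 : 1 ≤ a1) (ha2 : 1 ≤ a2) (ha : 4 < a1 * a2) :
    0 < alphaR a1 a2 ∧ 0 < betaR a1 a2 ∧ alphaR a1 a2 * betaR a1 a2 = a2 * alphaR a1 a2 - 1 ∧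
      alphaR a1 a2 * betaR a1 a2 = a1 * betaR a1 a2 - 1 ∧ 1 < alphaR a1 a2 * betaR a1 a2 ∧
      (a1 : ℝ) ≤ 2 * alphaR a1 a2 ∧ (a2 : ℝ) ≤ 2 * betaR a1 a2 := by
  have h1 : (1 : ℝ) ≤ a1 := by exact_mod_cast ha1
  have h2 : (1 : ℝ) ≤ a2 := by exact_mod_cast ha2
  have h : (4 : ℝ) < a1 * a2 := by exact_mod_cast ha
  have hs : 0 ≤ (a1 : ℝ) ^ 2 * (a2 : ℝ) ^ 2 - 4 * a1 * a2 := by nlinarith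
  have hr0 := Real.sqrt_nonneg ((a1 : ℝ) ^ 2 * (a2 : ℝ) ^ 2 - 4 * a1 * a2)
  have hr2 := Real.sq_sqrt hs
  unfold alphaR betaR
  set r := Real.sqrt ((a1 : ℝ) ^ 2 * (a2 : ℝ) ^ 2 - 4 * a1 * a2)
  have hprod : ((a1 : ℝ) * a2 + r) / (2 * a2) * (((a1 : ℝ) * a2 + r) / (2 * a1)) =
      ((a1 : ℝ) * a2 + r) / 2 - 1 := by
    field_simp
    linear_combination hr2
  refine ⟨by positivity, by positivity, ?_, ?_, ?_, ?_, ?_⟩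
  · rw [hprod]; field_simp
  · rw [hprod]; field_simp
  · rw [hprod]; linarith
  · rw [← mul_div_assoc, le_div_iff₀ (by positivity)]; linarith
  · rw [← mul_div_assoc, le_div_iff₀ (by positivity)]; linarith

lemma gammaR_pos (ha1 : 1 ≤ a1) (ha2 : 1 ≤ a2) (ha : 4 < a1 * a2)
    (k : ℤ) : 0 < gammaR a1 a2 k := by
  obtain ⟨h1, h2, -⟩ := alphaR_betaR_relations ha1 ha2 ha
  unfold gammaR
  split_ifs
  · exact h1
  · exact h2

lemma gammaR_succ_mul (ha1 : 1 ≤ a1) (ha2 : 1 ≤ a2) (ha : 4 < a1 * a2)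
    (k : ℤ) :
    gammaR a1 a2 (k + 1) * gammaR a1 a2 k = aIdx a1 a2 k * gammaR a1 a2 k - 1 := by
  obtain ⟨-, -, h1, h2, -⟩ := alphaR_betaR_relations ha1 ha2 ha
  unfold gammaR aIdx
  rcases Int.emod_two_eq_zero_or_one k with hk | hk
  · rw [if_neg (by lia), if_pos hk, if_neg (by lia)]
    linarith
  · rw [if_pos (by lia), if_neg (by lia), if_pos hk]
    linarith

lemma one_lt_gammaR_succ_mul (ha1 : 1 ≤ a1) (ha2 : 1 ≤ a2) (ha : 4 < a1 * a2)
    (k : ℤ) : 1 < gammaR a1 a2 (k + 1) * gammaR a1 a2 k := by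
  obtain ⟨-, -, -, -, h, -⟩ := alphaR_betaR_relations ha1 ha2 ha
  unfold gammaR
  rcases Int.emod_two_eq_zero_or_one k with hk | hk
  · rw [if_neg (by lia), if_pos hk]
    linarith
  · rw [if_pos (by lia), if_neg (by lia)]
    linarith

end Hyperbolic

/-- The sequence `0, 1, a_{i_K}, …` with alternating coefficients `a_{i_K}, a_{i_{K+1}}, …`. -/
def coneSeq (a1 a2 K : ℤ) : ℕ → ℤ
  | 0 => 0
  | 1 => 1
  | j + 2 => aIdx a1 a2 (K + j) * coneSeq a1 a2 K (j + 1) - coneSeq a1 a2 K j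

lemma coneSeq_of_odd {K : ℤ} (hK : K % 2 = 1) (j : ℕ) : coneSeq a1 a2 K j = cseq a1 a2 j := by
  induction j using Nat.strong_induction_on with
  | _ j ih =>
    match j with
    | 0 => rfl
    | 1 => rfl
    | j + 2 =>
      rw [coneSeq, cseq, ih (j + 1) (by lia), ih j (by lia)]
      have : ((K + j) % 2 = 1) ↔ j % 2 = 0 := by lia
      simp only [aIdx, this]

section Hyperbolic

lemma gammaR_mul_coneSeq_defect (ha1 : 1 ≤ a1) (ha2 : 1 ≤ a2) (ha : 4 < a1 * a2)
    (K : ℤ) (j : ℕ) :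
    gammaR a1 a2 (K + j) *
        (coneSeq a1 a2 K (j + 2) - gammaR a1 a2 (K + j + 1) * coneSeq a1 a2 K (j + 1)) =
      coneSeq a1 a2 K (j + 1) - gammaR a1 a2 (K + j) * coneSeq a1 a2 K j := by
  rw [coneSeq]
  push_cast
  linear_combination (-(coneSeq a1 a2 K (j + 1) : ℝ)) * gammaR_succ_mul ha1 ha2 ha (K + j)

lemma coneSeq_defect_pos (ha1 : 1 ≤ a1) (ha2 : 1 ≤ a2) (ha : 4 < a1 * a2)
    (K : ℤ) (j : ℕ) :
    0 < (coneSeq a1 a2 K (j + 1) : ℝ) - gammaR a1 a2 (K + j) * coneSeq a1 a2 K j := by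
  induction j with
  | zero => simp [coneSeq]
  | succ j ih =>
    rw [← gammaR_mul_coneSeq_defect ha1 ha2 ha] at ih
    push_cast
    rw [← add_assoc]
    exact (pos_iff_pos_of_mul_pos ih).1 (gammaR_pos ha1 ha2 ha _)

lemma coneSeq_succ_pos (ha1 : 1 ≤ a1) (ha2 : 1 ≤ a2) (ha : 4 < a1 * a2)
    (K : ℤ) (j : ℕ) : 0 < coneSeq a1 a2 K (j + 1) := by
  induction j with
  | zero => exact one_pos
  | succ j ih =>
    have h := coneSeq_defect_pos ha1 ha2 ha K (j + 1)
    have hp := mul_pos (gammaR_pos ha1 ha2 ha (K + (j + 1 : ℕ))) (Int.cast_pos (R := ℝ).2 ih)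
    exact_mod_cast hp.trans (sub_pos.1 h)

lemma coneSeq_nonneg (ha1 : 1 ≤ a1) (ha2 : 1 ≤ a2) (ha : 4 < a1 * a2)
    (K : ℤ) (j : ℕ) : 0 ≤ coneSeq a1 a2 K j := by
  cases j with
  | zero => exact le_rfl
  | succ j => exact (coneSeq_succ_pos ha1 ha2 ha K j).le

lemma pow_mul_coneSeq_defect (ha1 : 1 ≤ a1) (ha2 : 1 ≤ a2) (ha : 4 < a1 * a2)
    (K : ℤ) (m : ℕ) :
    (gammaR a1 a2 (K + 1) * gammaR a1 a2 K) ^ m *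
      (coneSeq a1 a2 K (2 * m + 1) - gammaR a1 a2 K * coneSeq a1 a2 K (2 * m)) = 1 := by
  induction m with
  | zero => simp [coneSeq]
  | succ m ih =>
    have h0 := gammaR_mul_coneSeq_defect ha1 ha2 ha K (2 * m)
    have h1 := gammaR_mul_coneSeq_defect ha1 ha2 ha K (2 * m + 1)
    rw [gammaR_congr (j := K + (2 * m : ℕ)) (k := K) (by lia),
      gammaR_congr (j := K + (2 * m : ℕ) + 1) (k := K + 1) (by lia)] at h0
    rw [gammaR_congr (j := K + (2 * m + 1 : ℕ)) (k := K + 1) (by lia),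
      gammaR_congr (j := K + (2 * m + 1 : ℕ) + 1) (k := K) (by lia)] at h1
    rw [← ih, ← h0, show 2 * (m + 1) = 2 * m + 1 + 1 from rfl, ← h1, pow_succ]
    ring

lemma isConeCoeff_coneSeq (ha1 : 1 ≤ a1) (ha2 : 1 ≤ a2) (ha : 4 < a1 * a2)
    (e : ℤ) (M : ℕ) :
    IsConeCoeff a1 a2 e M fun n => coneSeq a1 a2 (e + M - 1) (M - n) where
  eq_zero := by simp [coneSeq]
  pos n hn := by
    obtain ⟨j, rfl⟩ := Nat.exists_eq_add_of_lt hn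
    rw [show n + j + 1 - n = j + 1 by lia]
    exact coneSeq_succ_pos ha1 ha2 ha _ j
  recurrence n hn := by
    obtain ⟨j, rfl⟩ := Nat.exists_eq_add_of_lt hn
    rw [show n + 1 + j + 1 - n = j + 2 by lia, show n + 1 + j + 1 - (n + 1) = j + 1 by lia,
      show n + 1 + j + 1 - (n + 2) = j by lia, coneSeq]
    congr 2
    exact aIdx_congr (idx_eq_idx_iff.2 (by push_cast; lia))

/-- All `ε` along the chain vanish iff consecutive exponents satisfy the limiting inequalities. -/
theorem vanish_iff_gamma (ha1 : 1 ≤ a1) (ha2 : 1 ≤ a2) (ha : 4 < a1 * a2)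
    (s e : ℤ) {Y : ℕ → ℤ} (hY : ∀ n, 0 ≤ Y n) :
    (∀ n : ℕ, epsFrom a1 a2 s (chainFrom a1 a2 s e Y n) (idx (e + n)) = 0) ↔
      ∀ n : ℕ, (Y n : ℝ) ≤ gammaR a1 a2 (e + n + 1) * Y (n + 1) := by
  have hcone := fun M =>
    vanish_iff_cone (isConeCoeff_coneSeq ha1 ha2 ha e M) s (Y := Y) fun m _ => hY m
  constructor
  · intro h n
    by_contra hlt
    have hδ := sub_pos.2 (not_le.1 hlt)
    set g := gammaR a1 a2 (e + n + 1)
    set δ := (Y n : ℝ) - g * Y (n + 1)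
    set r := gammaR a1 a2 (e + n + 2) * g
    have hr : 1 < r := by
      have := one_lt_gammaR_succ_mul ha1 ha2 ha (e + n + 1)
      rwa [add_assoc (e + (n : ℤ)), one_add_one_eq_two] at this
    obtain ⟨m, hm⟩ := pow_unbounded_of_one_lt ((Y (n + 1) : ℝ) / δ) hr
    have hc := (hcone (n + 2 * (m + 1) + 2)).1 (fun k _ => h k) n (by lia)
    simp only [show n + 2 * (m + 1) + 2 - (n + 2) = 2 * (m + 1) by lia,
      show n + 2 * (m + 1) + 2 - (n + 1) = 2 * (m + 1) + 1 by lia] at hc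
    set K : ℤ := e + (n + 2 * (m + 1) + 2 : ℕ) - 1 with hK
    have hd := pow_mul_coneSeq_defect ha1 ha2 ha K (m + 1)
    rw [gammaR_congr (j := K) (k := e + n + 1) (by lia),
      gammaR_congr (j := K + 1) (k := e + n + 2) (by lia)] at hd
    change r ^ (m + 1) * (_ - g * _) = 1 at hd
    have hc1 : (1 : ℝ) ≤ coneSeq a1 a2 K (2 * (m + 1)) := by
      exact_mod_cast coneSeq_succ_pos ha1 ha2 ha K (2 * m + 1)
    have hcR : (coneSeq a1 a2 K (2 * (m + 1)) : ℝ) * Y n ≤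
        coneSeq a1 a2 K (2 * (m + 1) + 1) * Y (n + 1) := by exact_mod_cast hc
    have hrp : 0 < r ^ (m + 1) := by positivity
    have h1 : (coneSeq a1 a2 K (2 * (m + 1)) : ℝ) * δ ≤
        (coneSeq a1 a2 K (2 * (m + 1) + 1) - g * coneSeq a1 a2 K (2 * (m + 1))) * Y (n + 1) := by
      simp only [δ]
      linarith
    have h2 : r ^ (m + 1) * δ ≤ Y (n + 1) := by
      calc r ^ (m + 1) * δ ≤ r ^ (m + 1) * (coneSeq a1 a2 K (2 * (m + 1)) * δ) := by
            gcongr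
            exact le_mul_of_one_le_left hδ.le hc1
        _ ≤ r ^ (m + 1) * ((coneSeq a1 a2 K (2 * (m + 1) + 1) -
              g * coneSeq a1 a2 K (2 * (m + 1))) * Y (n + 1)) := by gcongr
        _ = Y (n + 1) := by rw [← mul_assoc, hd, one_mul]
    rw [div_lt_iff₀ hδ] at hm
    have h3 : r ^ m * δ ≤ r ^ (m + 1) * δ := by
      gcongr
      · exact hr.le
      · lia
    linarith
  · intro h n
    refine (hcone (n + 1)).2 (fun k hk => ?_) n (by lia)
    obtain ⟨j, hj⟩ := Nat.exists_eq_add_of_lt hk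
    obtain rfl : n = k + 1 + j := by lia
    simp only [show k + 1 + j + 1 - (k + 2) = j by lia,
      show k + 1 + j + 1 - (k + 1) = j + 1 by lia]
    set K : ℤ := e + (k + 1 + j + 1 : ℕ) - 1 with hK
    have hd := coneSeq_defect_pos ha1 ha2 ha K j
    rw [gammaR_congr (j := K + j) (k := e + k + 1) (by lia)] at hd
    have hc0 : (0 : ℝ) ≤ coneSeq a1 a2 K j := by exact_mod_cast coneSeq_nonneg ha1 ha2 ha K j
    have hY1 : (0 : ℝ) ≤ Y (k + 1) := by exact_mod_cast hY (k + 1)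
    have h1 := mul_le_mul_of_nonneg_left (h k) hc0
    have h2 := mul_le_mul_of_nonneg_right (sub_pos.1 hd).le hY1
    have h3 : (coneSeq a1 a2 K j : ℝ) * Y k ≤ coneSeq a1 a2 K (j + 1) * Y (k + 1) := by linarith
    exact_mod_cast h3

end Hyperbolic

section WeightSequence

variable {k1 k2 : ℤ}

lemma le_alphaR_mul (ha1 : 1 ≤ a1) (ha2 : 1 ≤ a2) (ha : 4 < a1 * a2) (hk2 : 0 < k2)
    (hreg : 2 ≤ a1 → 2 ≤ a2 →
      (k2 ≤ k1 ∧ k1 < (a1 - 1) * k2) ∨ (k1 < k2 ∧ k2 ≤ (a2 - 1) * k1))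
    (hdeg1 : a1 = 1 → 2 * k1 ≤ k2 ∧ k2 ≤ (a2 - 2) * k1)
    (hdeg2 : a2 = 1 → 2 * k2 ≤ k1 ∧ k1 ≤ (a1 - 2) * k2) :
    (k1 : ℝ) ≤ alphaR a1 a2 * k2 := by
  obtain ⟨-, hβ, -, hαβ, -, hα2, hβ2⟩ := alphaR_betaR_relations ha1 ha2 ha
  have hk2R : (0 : ℝ) < k2 := by exact_mod_cast hk2
  rcases ha1.eq_or_lt with h1 | h1
  · have h : (2 * k1 : ℝ) ≤ k2 := by exact_mod_cast (hdeg1 h1.symm).1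
    have h1R : (a1 : ℝ) = 1 := by exact_mod_cast h1.symm
    nlinarith
  have hbound : ∀ c : ℤ, 1 ≤ c * betaR a1 a2 → (a1 - c : ℝ) ≤ alphaR a1 a2 := by
    intro c hc
    by_contra! hlt
    nlinarith
  rcases ha2.eq_or_lt with h2 | h2
  · have h : (k1 : ℝ) ≤ (a1 - 2) * k2 := by exact_mod_cast (hdeg2 h2.symm).2
    have h2R : (a2 : ℝ) = 1 := by exact_mod_cast h2.symm
    have := hbound 2 (by push_cast; linarith)
    push_cast at this
    exact h.trans (by gcongr)
  · rcases hreg h1 h2 with ⟨-, h⟩ | ⟨h, -⟩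
    · have h2R : (2 : ℝ) ≤ a2 := by exact_mod_cast h2
      have hR : (k1 : ℝ) < (a1 - 1) * k2 := by exact_mod_cast h
      have := hbound 1 (by push_cast; linarith)
      push_cast at this
      exact hR.le.trans (by gcongr)
    · have h1R : (2 : ℝ) ≤ a1 := by exact_mod_cast h1
      have hR : (k1 : ℝ) < k2 := by exact_mod_cast h
      nlinarith

lemma pneg_succ_succ (n : ℕ) : pneg a1 a2 k1 k2 (n + 2) =
    aIdx a1 a2 n * pneg a1 a2 k1 k2 (n + 1) - pneg a1 a2 k1 k2 n := by
  rw [pneg, aIdx]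
  congr 2
  split_ifs <;> first | rfl | lia

lemma pneg_pos_and_le (ha1 : 1 ≤ a1) (ha2 : 1 ≤ a2) (ha : 4 < a1 * a2) (hk2 : 0 < k2)
    (h : (k1 : ℝ) ≤ alphaR a1 a2 * k2) (n : ℕ) :
    0 < pneg a1 a2 k1 k2 n ∧
      (pneg a1 a2 k1 k2 n : ℝ) ≤ gammaR a1 a2 (n + 1) * pneg a1 a2 k1 k2 (n + 1) := by
  induction n with
  | zero =>
    obtain ⟨-, hβ, -, hαβ, -⟩ := alphaR_betaR_relations ha1 ha2 ha
    refine ⟨hk2, ?_⟩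
    simp only [pneg, gammaR]
    norm_num
    linear_combination mul_le_mul_of_nonneg_left h hβ.le + (k2 : ℝ) * hαβ
  | succ n ih =>
    obtain ⟨hpos, hle⟩ := ih
    have hposR : (0 : ℝ) < pneg a1 a2 k1 k2 n := by exact_mod_cast hpos
    have hpos' : (0 : ℝ) < pneg a1 a2 k1 k2 (n + 1) :=
      pos_of_mul_pos_right (hposR.trans_le hle) (gammaR_pos ha1 ha2 ha _).le
    refine ⟨by exact_mod_cast hpos', ?_⟩
    rw [pneg_succ_succ, gammaR_congr (j := ((n + 1 : ℕ) : ℤ) + 1) (k := n) (by lia)]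
    push_cast
    have hγ := gammaR_succ_mul ha1 ha2 ha n
    have := mul_le_mul_of_nonneg_left hle (gammaR_pos ha1 ha2 ha n).le
    linear_combination this + (pneg a1 a2 k1 k2 (n + 1) : ℝ) * hγ

lemma pseq_neg (n : ℕ) : pseq a1 a2 k1 k2 (-n) = pneg a1 a2 k1 k2 n := by
  cases n with
  | zero => rfl
  | succ n => rw [pseq, if_neg (by lia), neg_neg, Int.toNat_natCast]

end WeightSequence

section Star

variable {x y : ℤ → ℤ} {N : ℕ}

lemma starPChain_chainFrom (hy : ∀ k, 1 ≤ k → y k = x k) {m : ℕ} (hm : m ≤ N) :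
    starPChain a1 a2 x m (chainFrom a1 a2 1 N (fun n => y (N - n)) (N - m)) =
      chainFrom a1 a2 1 N (fun n => y (N - n)) N := by
  induction m with
  | zero => rfl
  | succ m ih =>
    rw [starPChain, ← ih (by lia), show N - m = N - (m + 1) + 1 by lia, chainFrom,
      show (N : ℤ) - (N - (m + 1) : ℕ) = m + 1 by lia, hy (m + 1) (by lia),
      idx_eq_idx_iff.2 (show ((N : ℤ) + (N - (m + 1) : ℕ)) % 2 = ((m : ℤ) + 1) % 2 by omega)]
    rfl

lemma starPChain_eq_chainFrom (hy : ∀ k, 1 ≤ k → y k = x k) :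
    starPChain a1 a2 x N (fun _ => 0) = chainFrom a1 a2 1 N (fun n => y (N - n)) N := by
  rw [← starPChain_chainFrom hy le_rfl, Nat.sub_self]
  rfl

lemma fPnegChain_chainFrom {p : ℤ → ℤ} (hy : ∀ k, k ≤ 0 → y k = p k) (m : ℕ) :
    fPnegChain a1 a2 (fun k => (p k).toNat) m (chainFrom a1 a2 1 N (fun n => y (N - n)) N) =
      chainFrom a1 a2 1 N (fun n => y (N - n)) (N + m) := by
  induction m with
  | zero => rfl
  | succ m ih =>
    rw [fPnegChain, ih, ← add_assoc, chainFrom,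
      show (N : ℤ) - (N + m : ℕ) = -m by lia, hy (-m) (by lia),
      idx_eq_idx_iff.2 (show ((N : ℤ) + (N + m : ℕ)) % 2 = (-(m : ℤ)) % 2 by omega)]
    rfl

end Star

section Reflection

/-- The order-reversing, sign-changing reindexing `ℤ^{−∞} → ℤ^{≥ 0}`. -/
def refl (x : ℤ → ℤ) : ℤ → ℤ := fun k => -x (-k)

lemma refl_update (x : ℤ → ℤ) (k v : ℤ) :
    refl (Function.update x k v) = Function.update (refl x) (-k) (-v) := by
  funext l
  by_cases h : l = -k
  · subst h; simp [refl]
  · rw [Function.update_of_ne h, refl, Function.update_of_ne (by lia), refl]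

lemma sigmaM_eq_sigmaP_refl (x : ℤ → ℤ) (k : ℤ) :
    sigmaM a1 a2 x k = sigmaP a1 a2 (refl x) (-k) := by
  unfold sigmaM sigmaP refl
  rw [neg_neg, sub_eq_add_neg, ← finsum_neg_distrib, ← finsum_comp_equiv (Equiv.neg ℤ)]
  congr 1
  refine finsum_congr fun j => ?_
  have hp : pairJK a1 a2 (-j) k = pairJK a1 a2 j (-k) := by
    unfold pairJK
    simp only [show -j % 2 = k % 2 ↔ j % 2 = -k % 2 by lia, show -k % 2 = 1 ↔ k % 2 = 1 by lia]
  simp only [Equiv.neg_apply, hp, show -j < k ↔ -k < j by lia]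
  split_ifs <;> ring

lemma phiMf_eq_epsFrom_refl (x : ℤ → ℤ) (i : ℤ) :
    phiMf a1 a2 x i = epsFrom a1 a2 0 (refl x) i := by
  unfold phiMf epsFrom
  congr 1
  ext v
  refine ⟨fun ⟨k, h₁, h₂, h₃⟩ => ⟨-k, by lia, ?_, ?_⟩, fun ⟨k, h₁, h₂, h₃⟩ => ⟨-k, by lia, ?_, ?_⟩⟩
  · rw [← h₂, idx_eq_idx_iff]; lia
  · rw [← h₃, sigmaM_eq_sigmaP_refl]
  · rw [← h₂, idx_eq_idx_iff]; lia
  · rw [← h₃, sigmaM_eq_sigmaP_refl, neg_neg]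

lemma kmaxM_eq_neg_kminFrom_refl {x : ℤ → ℤ} (hx : BddSupp (refl x)) {i : ℤ} (hi : IsI i) :
    kmaxM a1 a2 x i = -kminFrom a1 a2 0 (refl x) i := by
  obtain ⟨⟨h₁, h₂, h₃⟩, hmin⟩ := isLeast_kminFrom (a1 := a1) (a2 := a2) hx 0 hi
  refine IsGreatest.csSup_eq ⟨⟨by lia, ?_, ?_⟩, fun k ⟨hk₁, hk₂, hk₃⟩ => ?_⟩
  · rw [← h₂, idx_eq_idx_iff]; lia
  · rw [sigmaM_eq_sigmaP_refl, neg_neg, h₃, phiMf_eq_epsFrom_refl]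
  · rw [sigmaM_eq_sigmaP_refl, phiMf_eq_epsFrom_refl] at hk₃
    have := hmin ⟨by lia, by rw [← hk₂, idx_eq_idx_iff]; lia, hk₃⟩
    lia

lemma refl_eM {x : ℤ → ℤ} (hx : BddSupp (refl x)) {i : ℤ} (hi : IsI i) :
    refl (eM a1 a2 i x) = fFrom a1 a2 0 i (refl x) := by
  rw [eM, refl_update, kmaxM_eq_neg_kminFrom_refl hx hi, fFrom, refl, neg_neg, neg_sub,
    sub_eq_neg_add]

lemma refl_iterate_eM {x : ℤ → ℤ} (hx : BddSupp (refl x)) {i : ℤ} (hi : IsI i) (n : ℕ) :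
    refl ((eM a1 a2 i)^[n] x) = (fFrom a1 a2 0 i)^[n] (refl x) := by
  induction n with
  | zero => rfl
  | succ n ih =>
    rw [Function.iterate_succ_apply', Function.iterate_succ_apply', ← ih, refl_eM _ hi]
    rw [ih]
    exact hx.iterate_fFrom 0 i n

lemma refl_eMposChain (g : ℤ → ℤ) (n : ℕ) :
    refl (eMposChain a1 a2 (fun k => (g k).toNat) n fun _ => 0) =
      chainFrom a1 a2 0 1 (fun n => g (n + 1)) n := by
  induction n with
  | zero => funext k; simp [eMposChain, chainFrom, refl]
  | succ n ih =>
    rw [eMposChain, eMiter, refl_iterate_eM (ih ▸ bddSupp_chainFrom 0 1 _ n) (idx_isI _), ih,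
      chainFrom, add_comm (1 : ℤ)]

end Reflection

section Main

variable {x p : ℤ → ℤ}

/-- The limiting inequalities for `x ∈ X+`, continued by `p` to the nonpositive positions, amount
to the vanishing of `ε` along the continuation of the chain defining `x*`. -/
theorem gamma_le_iff_epsP_fPnegChain_eq_zero (ha1 : 1 ≤ a1) (ha2 : 1 ≤ a2) (ha : 4 < a1 * a2)
    (hx : XPlusMem a1 a2 x) (hp0 : ∀ k ≤ 0, 0 ≤ p k)
    (hp : ∀ k ≤ 0, (p k : ℝ) ≤ gammaR a1 a2 (k - 1) * p (k - 1))
    (hxp : (x 1 : ℝ) ≤ gammaR a1 a2 0 * p 0) :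
    (∀ k : ℤ, 1 ≤ k → 0 ≤ gammaR a1 a2 k * (x k : ℝ) - (x (k + 1) : ℝ)) ↔
      ∀ j : ℤ, j ≤ 0 →
        epsP a1 a2 (fPnegChain a1 a2 (fun m => (p m).toNat) (-j).toNat (starP a1 a2 x))
          (idx j) = 0 := by
  obtain ⟨⟨-, hx0, hxN⟩, hcone⟩ := hx
  have hN : ∀ k : ℤ, (suppBoundP x : ℤ) < k → x k = 0 := Nat.sInf_mem hxN
  rw [starP]
  generalize suppBoundP x = N at hN ⊢
  have hy1 : ∀ k, 1 ≤ k → combine x p k = x k := fun k hk => if_pos hk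
  have hy0 : ∀ k, k ≤ 0 → combine x p k = p k := fun k hk => if_neg (by lia)
  rw [starPChain_eq_chainFrom hy1]
  simp only [fPnegChain_chainFrom hy0]
  set Y : ℕ → ℤ := fun n => combine x p (N - n) with hYdef
  have hY : ∀ n, 0 ≤ Y n := fun n => by
    by_cases h : 1 ≤ (N : ℤ) - n
    · simpa only [hYdef, hy1 _ h] using hx0 _
    · simpa only [hYdef, hy0 _ (not_lt.1 h)] using hp0 _ (not_lt.1 h)
  have hfirst : ∀ n < N, epsFrom a1 a2 1 (chainFrom a1 a2 1 N Y n) (idx (N + n)) = 0 := by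
    refine (vanish_iff_cone (isConeCoeff_coneSeq ha1 ha2 ha N N) 1 fun m _ => hY m).2
      fun n hn => ?_
    rw [coneSeq_of_odd (by lia), coneSeq_of_odd (by lia)]
    have h := hcone (N - n - 1) (by lia)
    rw [show ((N : ℤ) - n - 1 - 1).toNat = N - (n + 2) by lia,
      show ((N : ℤ) - n - 1).toNat = N - (n + 1) by lia, sub_add_cancel] at h
    simp only [hYdef, hy1 ((N : ℤ) - n) (by lia), hy1 ((N : ℤ) - (n + 1 : ℕ)) (by lia)]
    push_cast
    rw [← sub_sub]
    exact sub_nonneg.1 h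
  have hvanish : (∀ j : ℤ, j ≤ 0 →
      epsP a1 a2 (chainFrom a1 a2 1 N Y (N + (-j).toNat)) (idx j) = 0) ↔
      ∀ n : ℕ, epsFrom a1 a2 1 (chainFrom a1 a2 1 N Y n) (idx (N + n)) = 0 := by
    constructor
    · intro h n
      rcases lt_or_ge n N with hn | hn
      · exact hfirst n hn
      · have := h (N - n) (by lia)
        rwa [show N + (-((N : ℤ) - n)).toNat = n by lia,
          idx_eq_idx_iff.2 (show ((N : ℤ) - n) % 2 = ((N : ℤ) + n) % 2 by lia)] at this
    · intro h j hj
      have := h (N + (-j).toNat)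
      rwa [idx_eq_idx_iff.2
        (show ((N : ℤ) + (N + (-j).toNat : ℕ)) % 2 = j % 2 by omega)] at this
  rw [hvanish, vanish_iff_gamma ha1 ha2 ha 1 N hY]
  constructor
  · intro h n
    rw [gammaR_congr (k := N - n - 1) (by lia)]
    simp only [hYdef]
    push_cast
    rw [← sub_sub]
    rcases lt_trichotomy ((N : ℤ) - n) 1 with hn | hn | hn
    · rw [hy0 _ (by lia), hy0 _ (by lia)]
      exact hp _ (by lia)
    · rw [hn, hy1 1 le_rfl, sub_self, hy0 0 le_rfl]
      exact hxp
    · rw [hy1 _ (by lia), hy1 _ (by lia)]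
      have := h (N - n - 1) (by lia)
      rw [sub_add_cancel] at this
      exact sub_nonneg.1 this
  · intro h k hk
    have hγ := (gammaR_pos ha1 ha2 ha k).le
    rcases lt_or_ge k N with hkN | hkN
    · have := h (N - k - 1).toNat
      rw [gammaR_congr (k := k) (by lia)] at this
      simp only [hYdef] at this
      rw [show (N : ℤ) - (((N : ℤ) - k - 1).toNat + 1 : ℕ) = k by lia,
        show (N : ℤ) - ((N : ℤ) - k - 1).toNat = k + 1 by lia, hy1 _ hk, hy1 _ (by lia)] at this
      exact sub_nonneg.2 this
    · rw [hN (k + 1) (by lia), Int.cast_zero, sub_zero]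
      exact mul_nonneg hγ (by exact_mod_cast hx0 k)

/-- The limiting inequalities for `p - x` amount to the vanishing of `φ` along the chain of
operators `ẽ` with exponents `p - x`. -/
theorem gamma_le_iff_phiMf_eMposChain_eq_zero (ha1 : 1 ≤ a1) (ha2 : 1 ≤ a2) (ha : 4 < a1 * a2)
    (hxp : ∀ m : ℤ, 1 ≤ m → x m ≤ p m) :
    (∀ k : ℤ, 1 ≤ k → 0 ≤ gammaR a1 a2 (k + 1) * (p (k + 1) : ℝ) - (p k : ℝ) + (x k : ℝ) -
        gammaR a1 a2 (k + 1) * (x (k + 1) : ℝ)) ↔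
      ∀ j : ℤ, 1 ≤ j →
        phiMf a1 a2 (eMposChain a1 a2 (fun m => (p m - x m).toNat) (j - 1).toNat (fun _ => 0))
          (idx j) = 0 := by
  have hY : ∀ n : ℕ, 0 ≤ p (n + 1) - x (n + 1) := fun n => sub_nonneg.2 (hxp _ (by lia))
  have key := vanish_iff_gamma ha1 ha2 ha 0 1 hY
  simp only [phiMf_eq_epsFrom_refl, refl_eMposChain fun m => p m - x m]
  constructor
  · intro h j hj
    obtain ⟨n, rfl⟩ := Int.le.dest hj
    rw [add_sub_cancel_left, Int.toNat_natCast]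
    refine key.2 (fun n => ?_) n
    have := h (n + 1) (by lia)
    rw [add_comm (1 : ℤ)]
    push_cast
    linarith
  · intro h k hk
    obtain ⟨n, rfl⟩ := Int.le.dest hk
    have := key.1 (fun n => by simpa using h (1 + n) (by lia)) n
    rw [Nat.cast_add_one, add_comm (n : ℤ) 1] at this
    push_cast at this
    linarith

end Main

end HypCrystal

open HypCrystal in
theorem gamma_ineqs_iff_eps_phi_vanish
    (a1 a2 : ℤ) (ha1 : 1 ≤ a1) (ha2 : 1 ≤ a2) (ha : 4 < a1 * a2)
    (k1 k2 : ℤ) (hk1 : 0 < k1) (hk2 : 0 < k2)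
    (hreg : 2 ≤ a1 → 2 ≤ a2 →
      (k2 ≤ k1 ∧ k1 < (a1 - 1) * k2) ∨ (k1 < k2 ∧ k2 ≤ (a2 - 1) * k1))
    (hdeg1 : a1 = 1 → 2 * k1 ≤ k2 ∧ k2 ≤ (a2 - 2) * k1)
    (hdeg2 : a2 = 1 → 2 * k2 ≤ k1 ∧ k1 ≤ (a1 - 2) * k2)
    (x : ℤ → ℤ) (hx : XPlusMem a1 a2 x)
    (hxp : ∀ m : ℤ, 1 ≤ m → x m ≤ pseq a1 a2 k1 k2 m) :
    ((∀ k : ℤ, 1 ≤ k → 0 ≤ gammaR a1 a2 k * (x k : ℝ) - (x (k + 1) : ℝ)) ↔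
      (∀ j : ℤ, j ≤ 0 →
        epsP a1 a2
          (fPnegChain a1 a2 (fun m => (pseq a1 a2 k1 k2 m).toNat) (-j).toNat
            (starP a1 a2 x))
          (idx j) = 0)) ∧
    ((∀ k : ℤ, 1 ≤ k →
        0 ≤ gammaR a1 a2 (k + 1) * (pseq a1 a2 k1 k2 (k + 1) : ℝ) -
            (pseq a1 a2 k1 k2 k : ℝ) + (x k : ℝ) -
            gammaR a1 a2 (k + 1) * (x (k + 1) : ℝ)) ↔
      (∀ j : ℤ, 1 ≤ j →
        phiMf a1 a2
          (eMposChain a1 a2 (fun m => (pseq a1 a2 k1 k2 m - x m).toNat) (j - 1).toNat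
            (fun _ => 0))
          (idx j) = 0)) := by
  have hα := le_alphaR_mul ha1 ha2 ha hk2 hreg hdeg1 hdeg2
  have hp := pneg_pos_and_le ha1 ha2 ha hk2 hα
  refine ⟨gamma_le_iff_epsP_fPnegChain_eq_zero ha1 ha2 ha hx (fun k hk => ?_) (fun k hk => ?_) ?_,
    gamma_le_iff_phiMf_eMposChain_eq_zero ha1 ha2 ha hxp⟩
  · obtain ⟨n, rfl⟩ := Int.exists_eq_neg_ofNat hk
    rw [pseq_neg]
    exact (hp n).1.le
  · obtain ⟨n, rfl⟩ := Int.exists_eq_neg_ofNat hk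
    rw [pseq_neg, show -(n : ℤ) - 1 = -(n + 1 : ℕ) by lia, pseq_neg,
      gammaR_congr (k := n + 1) (by lia)]
    exact (hp n).2
  · have h1 : (x 1 : ℝ) ≤ k1 := by exact_mod_cast hxp 1 le_rfl
    exact h1.trans hα
end
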